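/- If G is a finite solvable group and p is a prime dividing |G|, then every connected component of the geometric realization of K(A_p(G)) has free fundamental group. -/

import Mathlib

open Function

/-- The geometric realization of the order complex of the subposet `S` of `X`,
realized as a subspace of `X → ℝ`: convex combinations supported on finite
nonempty chains contained in `S`. -/
def geomRealOn {X : Type*} [Preorder X] (S : Set X) : Set (X → ℝ) :=
  {f | (∀ x, 0 ≤ f x) ∧ Function.support f ⊆ S ∧ IsChain (· ≤ ·) (Function.support f) ∧
    ∃ s : Finset X, Function.support f ⊆ ↑s ∧ ∑ x ∈ s, f x = 1}

/-- A group is elementary abelian for the prime `p` if it is abelian and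
every element has order dividing `p`. -/
def IsElementaryAbelian (p : ℕ) (G : Type*) [Group G] : Prop :=
  (∀ a b : G, a * b = b * a) ∧ ∀ a : G, a ^ p = 1

/-- The Quillen poset `A_p(G)`: nontrivial elementary abelian `p`-subgroups of `G`. -/
def apSet (p : ℕ) (G : Type*) [Group G] : Set (Subgroup G) :=
  {H | H ≠ ⊥ ∧ IsElementaryAbelian p ↥H}

/-- A family `c` is a cocycle on the nerve of the family of sets `U` when
`c i j * c j k = c i k` on all nonempty triple intersections. -/
def IsNerveCocycle {B I : Type} (U : I → Set B) {H : Type} [Group H] (c : I → I → H) : Prop :=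
  ∀ i j k, (U i ∩ U j ∩ U k).Nonempty → c i j * c j k = c i k

theorem IsNerveCocycle.self {B I : Type} {U : I → Set B} {H : Type} [Group H] {c : I → I → H}
    (hc : IsNerveCocycle U c) {i : I} (hi : (U i).Nonempty) : c i i = 1 := by
  have := hc i i i (by simpa using hi)
  simpa using this

/-- The total space of the principal `E`-bundle defined by a nerve cocycle; `ι` chooses a chart
at each point. -/
def NerveBundle {B I E : Type} (_U : I → Set B) (_ι : B → I) (_c : I → I → E) : Type := B × E

namespace NerveBundle

variable {B I E : Type} [Group E] {U : I → Set B} {ι : B → I} {c : I → I → E}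

/-- The constant local section with value `e` in the chart `i`. -/
def sec (U : I → Set B) (ι : B → I) (c : I → I → E) (i : I) (e : E) (b : U i) :
    NerveBundle U ι c := ((b : B), e * c i (ι b))

/-- The projection to the base. -/
def proj (x : NerveBundle U ι c) : B := x.1

instance [TopologicalSpace B] : TopologicalSpace (NerveBundle U ι c) :=
  ⨆ (i : I) (e : E), TopologicalSpace.coinduced (sec U ι c i e) inferInstance

instance : MulAction E (NerveBundle U ι c) where
  smul g x := (x.1, g * x.2)
  one_smul _ := Prod.ext rfl (one_mul _)
  mul_smul _ _ _ := Prod.ext rfl (mul_assoc _ _ _)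

theorem smul_sec (g : E) (i : I) (e : E) (b : U i) :
    g • sec U ι c i e b = sec U ι c i (g * e) b :=
  Prod.ext rfl (mul_assoc _ _ _).symm

theorem exists_sec_eq (hι : ∀ b, b ∈ U (ι b)) (hc : IsNerveCocycle U c) (x : NerveBundle U ι c) :
    sec U ι c (ι x.1) x.2 ⟨x.1, hι _⟩ = x := by
  refine Prod.ext rfl ?_
  change x.2 * c (ι x.1) (ι x.1) = x.2
  rw [hc.self ⟨_, hι _⟩, mul_one]

variable [TopologicalSpace B]

theorem isOpen_iff {W : Set (NerveBundle U ι c)} :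
    IsOpen W ↔ ∀ i e, IsOpen (sec U ι c i e ⁻¹' W) := by
  simp only [isOpen_iSup_iff, isOpen_coinduced]

theorem continuous_iff {Z : Type} [TopologicalSpace Z] {f : NerveBundle U ι c → Z} :
    Continuous f ↔ ∀ i e, Continuous (f ∘ sec U ι c i e) := by
  simp only [continuous_iSup_dom, continuous_coinduced_dom]

theorem continuous_sec (i : I) (e : E) : Continuous (sec U ι c i e) :=
  continuous_def.2 fun _ hW => isOpen_iff.1 hW i e

theorem isOpen_range_sec (hU : ∀ i, IsOpen (U i)) (hι : ∀ b, b ∈ U (ι b))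
    (hc : IsNerveCocycle U c) (i : I) (e : E) : IsOpen (Set.range (sec U ι c i e)) := by
  rw [isOpen_iff]
  intro j e'
  by_cases h : e' * c j i = e
  · have : sec U ι c j e' ⁻¹' Set.range (sec U ι c i e) = Subtype.val ⁻¹' (U i) := by
      ext b
      constructor
      · rintro ⟨b', hb'⟩
        have : (b' : B) = b := congrArg Prod.fst hb'
        exact (congrArg (· ∈ U i) this).mp b'.2
      · intro hb
        refine ⟨⟨b, hb⟩, Prod.ext rfl ?_⟩
        change e * c i (ι b) = e' * c j (ι b)
        rw [← h, mul_assoc, hc j i (ι b) ⟨b, ⟨b.2, hb⟩, hι b⟩]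
    rw [this]
    exact (hU i).preimage continuous_subtype_val
  · have : sec U ι c j e' ⁻¹' Set.range (sec U ι c i e) = ∅ := by
      rw [Set.eq_empty_iff_forall_notMem]
      rintro b ⟨b', hb'⟩
      have h1 : (b' : B) = b := congrArg Prod.fst hb'
      have h2 : e * c i (ι b') = e' * c j (ι b) := congrArg Prod.snd hb'
      apply h
      have hbi : (b : B) ∈ U i := h1 ▸ b'.2
      rw [h1, ← hc j i (ι b) ⟨b, ⟨b.2, hbi⟩, hι b⟩, ← mul_assoc] at h2
      exact (mul_right_cancel h2).symm
    rw [this]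
    exact isOpen_empty

theorem isQuotientCoveringMap_proj (hU : ∀ i, IsOpen (U i)) (hι : ∀ b, b ∈ U (ι b))
    (hc : IsNerveCocycle U c) : IsQuotientCoveringMap (proj (U := U) (ι := ι) (c := c)) E where
  toIsQuotientMap := by
    rw [Topology.isQuotientMap_iff]
    refine ⟨.of_isOpen_preimage_iff_isOpen fun V => ⟨fun hV => ?_, fun hV => ?_⟩,
      fun b => ⟨(show NerveBundle U ι c from (b, 1)), rfl⟩⟩
    · rw [isOpen_iff] at hV
      have : V = ⋃ i, (Subtype.val '' (sec U ι c i 1 ⁻¹' (proj ⁻¹' V))) := by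
        ext b
        simp only [Set.mem_iUnion]
        constructor
        · intro hb
          exact ⟨ι b, ⟨b, hι b⟩, hb, rfl⟩
        · rintro ⟨i, b', hb', rfl⟩
          exact hb'
      rw [this]
      exact isOpen_iUnion fun i => (hU i).isOpenMap_subtype_val _ (hV i 1)
    · rw [isOpen_iff]
      intro i e
      exact hV.preimage continuous_subtype_val
  continuous_const_smul g := by
    rw [continuous_iff]
    intro i e
    have : (fun x => g • x) ∘ sec U ι c i e = sec U ι c i (g * e) := by
      ext1 b
      exact smul_sec g i e b
    rw [this]
    exact continuous_sec i _
  apply_eq_iff_mem_orbit {e₁ e₂} := by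
    constructor
    · intro h
      refine ⟨e₁.2 * e₂.2⁻¹, Prod.ext h.symm ?_⟩
      exact inv_mul_cancel_right _ _
    · rintro ⟨g, rfl⟩
      rfl
  disjoint x := by
    refine ⟨Set.range (sec U ι c (ι x.1) x.2), (isOpen_range_sec hU hι hc _ _).mem_nhds
      ⟨⟨x.1, hι _⟩, Prod.ext rfl ?_⟩, ?_⟩
    · change x.2 * c (ι x.1) (ι x.1) = x.2
      rw [hc.self ⟨_, hι _⟩, mul_one]
    · rintro g ⟨_, ⟨_, ⟨b, rfl⟩, rfl⟩, b', hb'⟩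
      simp only [smul_sec] at hb'
      have h1 : (b' : B) = b := congrArg Prod.fst hb'
      have h2 : _ * c _ (ι b') = (g * _) * c _ (ι b) := congrArg Prod.snd hb'
      rw [h1] at h2
      have := mul_right_cancel h2
      exact right_eq_mul.1 this

end NerveBundle

namespace FundamentalGroup

variable {B : Type} [TopologicalSpace B] (x₀ : B)

open Classical in
/-- A multiplicative extension of path classes to elements of the opposite fundamental group,
obtained by joining points to the base point. Path classes outside the component of the base
point are sent to `1`. -/
noncomputable def holonomy {a b : B} (γ : Path.Homotopic.Quotient a b) :
    (FundamentalGroup B x₀)ᵐᵒᵖ :=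
  if h : Joined x₀ a ∧ Joined x₀ b then
    MulOpposite.op (((Path.Homotopic.Quotient.mk h.1.somePath).trans γ).trans
      (Path.Homotopic.Quotient.mk h.2.somePath).symm)
  else 1

theorem joined_of_quotient {a b : B} (γ : Path.Homotopic.Quotient a b) : Joined a b := by
  obtain ⟨γ⟩ := γ
  exact ⟨γ⟩

theorem holonomy_trans {a b c : B} (γ : Path.Homotopic.Quotient a b)
    (δ : Path.Homotopic.Quotient b c) :
    holonomy x₀ (γ.trans δ) = holonomy x₀ γ * holonomy x₀ δ := by
  have hγ := joined_of_quotient γ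
  have hδ := joined_of_quotient δ
  by_cases h : Joined x₀ a
  · rw [holonomy, holonomy, holonomy, dif_pos ⟨h, h.trans (hγ.trans hδ)⟩, dif_pos ⟨h, h.trans hγ⟩,
      dif_pos ⟨h.trans hγ, h.trans (hγ.trans hδ)⟩, ← MulOpposite.op_mul, FundamentalGroup.mul_def]
    congr 1
    simp only [Path.Homotopic.Quotient.trans_assoc]
    congr 2
    rw [← Path.Homotopic.Quotient.trans_assoc _ _ (Path.Homotopic.Quotient.trans δ _),
      Path.Homotopic.Quotient.symm_trans, Path.Homotopic.Quotient.refl_trans]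
  · rw [holonomy, holonomy, holonomy, dif_neg fun h' => h h'.1, dif_neg fun h' => h h'.1,
      dif_neg fun h' => h (h'.1.trans hγ.symm), mul_one]

theorem holonomy_refl (a : B) : holonomy x₀ (.refl a) = 1 := by
  have := holonomy_trans x₀ (.refl a) (.refl a)
  rw [Path.Homotopic.Quotient.refl_trans] at this
  simpa using this

theorem eq_one_of_holonomy_eq_one {γ : FundamentalGroup B x₀}
    (h : holonomy x₀ (show Path.Homotopic.Quotient x₀ x₀ from γ) = 1) : γ = 1 := by
  have hx : Joined x₀ x₀ ∧ Joined x₀ x₀ := ⟨.refl _, .refl _⟩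
  rw [holonomy, dif_pos hx, MulOpposite.op_eq_one_iff] at h
  set τ : FundamentalGroup B x₀ := Path.Homotopic.Quotient.mk hx.1.somePath
  change τ⁻¹ * (γ * τ) = 1 at h
  rwa [inv_mul_eq_one, right_eq_mul] at h

theorem holonomy_cast {a b a' b' : B} (γ : Path.Homotopic.Quotient a b) (ha : a' = a)
    (hb : b' = b) : holonomy x₀ (γ.cast ha hb) = holonomy x₀ γ := by
  subst ha hb
  rw [Path.Homotopic.Quotient.cast_rfl_rfl]

/-- Over a simply connected subset, holonomy is the coboundary of a function. -/
theorem exists_holonomy_primitive {V : Set B} (hV : IsSimplyConnected V) :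
    ∃ ρ : B → (FundamentalGroup B x₀)ᵐᵒᵖ, ∀ {a b : B} (γ : Path a b), Set.range γ ⊆ V →
      ρ a * holonomy x₀ (.mk γ) = ρ b := by
  classical
  have := hV.simplyConnectedSpace
  obtain ⟨v₀⟩ : Nonempty V := hV.nonempty.to_subtype
  let incl : C(V, B) := ⟨Subtype.val, continuous_subtype_val⟩
  refine ⟨fun b => if h : b ∈ V then holonomy x₀ ((Path.Homotopic.Quotient.mk
    (PathConnectedSpace.somePath v₀ ⟨b, h⟩)).map incl) else 1, ?_⟩
  intro a b γ hγ
  have ha : a ∈ V := hγ ⟨0, γ.source⟩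
  have hb : b ∈ V := hγ ⟨1, γ.target⟩
  simp only [dif_pos ha, dif_pos hb]
  let γ' : Path (⟨a, ha⟩ : V) ⟨b, hb⟩ :=
    { toFun := fun t => ⟨γ t, hγ ⟨t, rfl⟩⟩
      continuous_toFun := by fun_prop
      source' := by simp
      target' := by simp }
  have h1 : Path.Homotopic.Quotient.mk γ = (Path.Homotopic.Quotient.mk γ').map incl := rfl
  rw [h1, ← holonomy_trans]
  have h2 : (Path.Homotopic.Quotient.mk (PathConnectedSpace.somePath v₀ ⟨b, hb⟩)) =
      (Path.Homotopic.Quotient.mk (PathConnectedSpace.somePath v₀ ⟨a, ha⟩)).trans (.mk γ') :=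
    Subsingleton.elim _ _
  rw [h2]
  exact congrArg (fun P => holonomy x₀ (.mk P)) (Path.map_trans _ _ incl.continuous).symm

end FundamentalGroup

open FundamentalGroup in
/-- A function along a path which locally changes by holonomy does so globally. -/
theorem eq_mul_holonomy_of_locally {B : Type} [TopologicalSpace B] (x₀ : B) {a b : B}
    (γ : Path a b) (φ : unitInterval → (FundamentalGroup B x₀)ᵐᵒᵖ)
    (h : ∀ t, ∃ W ∈ nhds t, ∀ s ∈ W, Set.uIcc t s ⊆ W →
      φ s = φ t * holonomy x₀ (.mk (γ.subpath t s))) :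
    φ 1 = φ 0 * holonomy x₀ (.mk γ) := by
  let ψ : unitInterval → (FundamentalGroup B x₀)ᵐᵒᵖ := fun t =>
    φ t * (holonomy x₀ (.mk (γ.subpath 0 t)))⁻¹
  have hψ : IsLocallyConstant ψ := by
    rw [IsLocallyConstant.iff_eventually_eq]
    intro t
    obtain ⟨W, hW, hs⟩ := h t
    obtain ⟨l, r, ht, hlr, hsub⟩ := exists_Icc_mem_subset_of_mem_nhds hW
    filter_upwards [hlr] with s hs'
    have hts : φ s = φ t * holonomy x₀ (.mk (γ.subpath t s)) :=
      hs s (hsub hs') ((Set.uIcc_subset_Icc ht hs').trans hsub)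
    have : holonomy x₀ (.mk (γ.subpath 0 s)) = holonomy x₀ (.mk (γ.subpath 0 t)) *
        holonomy x₀ (.mk (γ.subpath t s)) := by
      rw [← holonomy_trans]
      congr 1
      exact (Path.Homotopic.Quotient.eq.mpr ⟨Path.Homotopy.subpathTransSubpath γ 0 t s⟩).symm
    simp only [ψ, hts, this]
    group
  have h01 : ψ 1 = ψ 0 := hψ.apply_eq_of_isPreconnected isPreconnected_univ trivial trivial
  have e1 : holonomy x₀ (.mk (γ.subpath 0 1)) = holonomy x₀ (.mk γ) := by
    rw [Path.subpath_zero_one]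
    exact holonomy_cast x₀ (.mk γ) _ _
  have e0 : holonomy x₀ (.mk (γ.subpath 0 0)) = 1 := by
    rw [Path.subpath_self]
    exact holonomy_refl x₀ _
  simp only [ψ, e1, e0, inv_one, mul_one] at h01
  rw [← h01, inv_mul_cancel_right]

open FundamentalGroup in
/-- If every nerve cocycle of a good open cover lifts along surjections of groups, then the
fundamental group is free. -/
theorem isFreeGroup_fundamentalGroup_of_lift {B I : Type} [TopologicalSpace B] {U : I → Set B}
    (hU : ∀ i, IsOpen (U i)) (hcover : ∀ b, ∃ i, b ∈ U i) (hsc : ∀ i, IsSimplyConnected (U i))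
    (hpc : ∀ i j, (U i ∩ U j).Nonempty → IsPathConnected (U i ∩ U j))
    (hlift : ∀ (H E : Type) [Group H] [Group E] (q : E →* H), Surjective q →
      ∀ c : I → I → H, IsNerveCocycle U c → ∃ d : I → I → E, IsNerveCocycle U d ∧
        ∀ i j, (U i ∩ U j).Nonempty → q (d i j) = c i j) (x₀ : B) :
    IsFreeGroup (FundamentalGroup B x₀) := by
  classical
  choose ι hι using hcover
  choose ρ hρ using fun i => exists_holonomy_primitive x₀ (hsc i)
  let c : I → I → (FundamentalGroup B x₀)ᵐᵒᵖ := fun i j =>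
    if h : (U i ∩ U j).Nonempty then ρ i h.some * (ρ j h.some)⁻¹ else 1
  have hc : ∀ i j b, b ∈ U i → b ∈ U j → c i j = ρ i b * (ρ j b)⁻¹ := by
    intro i j b hi hj
    have h : (U i ∩ U j).Nonempty := ⟨b, hi, hj⟩
    simp only [c, dif_pos h]
    obtain ⟨γ, hγ⟩ := (hpc i j h).joinedIn _ h.some_mem b ⟨hi, hj⟩
    rw [← hρ i γ (by rintro _ ⟨t, rfl⟩; exact (hγ t).1),
      ← hρ j γ (by rintro _ ⟨t, rfl⟩; exact (hγ t).2)]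
    group
  have hcc : IsNerveCocycle U c := by
    rintro i j k ⟨b, ⟨hi, hj⟩, hk⟩
    rw [hc i j b hi hj, hc j k b hj hk, hc i k b hi hk]
    group
  let q : FreeGroup (FundamentalGroup B x₀)ᵐᵒᵖ →* (FundamentalGroup B x₀)ᵐᵒᵖ := FreeGroup.lift id
  have hq : Surjective q := fun z => ⟨FreeGroup.of z, by simp [q]⟩
  obtain ⟨d, hd, hqd⟩ := hlift _ _ q hq c hcc
  let p := NerveBundle.proj (U := U) (ι := ι) (c := d)
  have hp : IsQuotientCoveringMap p _ := NerveBundle.isQuotientCoveringMap_proj hU hι hd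
  let Φ : NerveBundle U ι d → (FundamentalGroup B x₀)ᵐᵒᵖ := fun x => q x.2 * ρ (ι x.1) x.1
  have hΦ : ∀ i e (b : U i), Φ (NerveBundle.sec U ι d i e b) = q e * ρ i b := by
    intro i e b
    change q (e * d i (ι b)) * ρ (ι b) b = _
    rw [map_mul, hqd i _ ⟨b, b.2, hι b⟩, hc i (ι b) b b.2 (hι b)]
    group
  have key : ∀ {y z : NerveBundle U ι d} (δ : Path y z),
      Φ z = Φ y * holonomy x₀ (.mk (δ.map hp.continuous)) := by
    intro y z δ
    have := eq_mul_holonomy_of_locally x₀ (δ.map hp.continuous) (fun t => Φ (δ t)) ?_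
    · simpa using this
    intro t
    let V := Set.range (NerveBundle.sec U ι d (ι (δ t).1) (δ t).2)
    have hsub : ∀ s, δ s ∈ V → p (δ s) ∈ U (ι (δ t).1) ∧
        Φ (δ s) = q (δ t).2 * ρ (ι (δ t).1) (p (δ s)) := by
      rintro s ⟨b, hb⟩
      rw [← hb]
      exact ⟨b.2, hΦ _ _ b⟩
    have hmem : δ t ∈ V := ⟨_, NerveBundle.exists_sec_eq hι hd _⟩
    refine ⟨δ ⁻¹' V, ((NerveBundle.isOpen_range_sec hU hι hd _ _).preimage
      δ.continuous).mem_nhds hmem, fun s hs hts => ?_⟩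
    rw [(hsub s hs).2, (hsub t hmem).2, mul_assoc]
    congr 1
    refine (hρ _ ((δ.map hp.continuous).subpath t s) ?_).symm
    rw [Path.range_subpath]
    rintro _ ⟨r, hr, rfl⟩
    exact (hsub r (hts hr)).1
  let e : p ⁻¹' {x₀} := ⟨(x₀, 1), rfl⟩
  have hinj : Injective (hp.fundamentalGroupToMulOpposite e) := by
    rw [injective_iff_map_eq_one]
    intro γ hγ
    have hmem : γ ∈ (hp.fundamentalGroupToMulOpposite e).ker := hγ
    rw [hp.ker_fundamentalGroupToMulOpposite, hp.ker_monodromyPerm e] at hmem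
    obtain ⟨δ, rfl⟩ := hmem
    refine (mapOfEq_apply (f := ⟨p, hp.continuous⟩) (h := rfl) δ).trans ?_
    obtain ⟨δ⟩ := δ
    apply eq_one_of_holonomy_eq_one
    have := key δ
    rw [left_eq_mul] at this
    exact this
  let j := (MulEquiv.inv' (FreeGroup (FundamentalGroup B x₀)ᵐᵒᵖ)).symm.toMonoidHom.comp
    (hp.fundamentalGroupToMulOpposite e)
  have hj : Injective j := (MulEquiv.injective (MulEquiv.inv' _).symm).comp hinj
  exact IsFreeGroup.ofMulEquiv (MonoidHom.ofInjective hj).symm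

/-- A function `c` on pairs in a preorder is a cocycle when `c x y * c y z = c x z` for
`x ≤ y ≤ z`. -/
def IsPosetCocycle {P H : Type} [Preorder P] [Group H] (c : P → P → H) : Prop :=
  ∀ x y z, x ≤ y → y ≤ z → c x y * c y z = c x z

/-- A preorder has the cocycle lifting property when cocycles with values in any group lift along
any surjection onto that group. -/
def HasCocycleLifting (P : Type) [Preorder P] : Prop :=
  ∀ (H E : Type) [Group H] [Group E] (q : E →* H), Surjective q → ∀ c : P → P → H,
    IsPosetCocycle c → ∃ d : P → P → E, IsPosetCocycle d ∧ ∀ x y, x ≤ y → q (d x y) = c x y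

theorem IsPosetCocycle.self {P H : Type} [Preorder P] [Group H] {c : P → P → H}
    (hc : IsPosetCocycle c) (x : P) : c x x = 1 := by
  simpa using hc x x x le_rfl le_rfl

section GeometricRealization

open Classical in
theorem support_single_one {X : Type} (x : X) : support (Pi.single x 1 : X → ℝ) = {x} := by simp

variable {X : Type} [PartialOrder X] {S : Set X}

theorem combo_mem_geomRealOn {f g : X → ℝ} (hf : f ∈ geomRealOn S) (hg : g ∈ geomRealOn S)
    (h : IsChain (· ≤ ·) (support f ∪ support g)) {a b : ℝ} (ha : 0 ≤ a) (hb : 0 ≤ b)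
    (hab : a + b = 1) : a • f + b • g ∈ geomRealOn S := by
  classical
  obtain ⟨hf0, hfS, -, s, hs, hs1⟩ := hf
  obtain ⟨hg0, hgS, -, t, ht, ht1⟩ := hg
  have hsub : support (a • f + b • g) ⊆ support f ∪ support g := by
    intro x hx
    by_contra hx'
    simp only [Set.mem_union, mem_support, not_or, not_not] at hx'
    simp [hx'.1, hx'.2] at hx
  refine ⟨fun x => ?_, hsub.trans (Set.union_subset hfS hgS), h.mono hsub, s ∪ t, ?_, ?_⟩
  · simp only [Pi.add_apply, Pi.smul_apply, smul_eq_mul]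
    have := hf0 x
    have := hg0 x
    positivity
  · rw [Finset.coe_union]
    exact hsub.trans (Set.union_subset_union hs ht)
  · have h1 : ∑ x ∈ s ∪ t, f x = 1 := by
      rw [← hs1]
      exact (Finset.sum_subset Finset.subset_union_left fun x _ hx => by
        by_contra hne; exact hx (hs hne)).symm
    have h2 : ∑ x ∈ s ∪ t, g x = 1 := by
      rw [← ht1]
      exact (Finset.sum_subset Finset.subset_union_right fun x _ hx => by
        by_contra hne; exact hx (ht hne)).symm
    simp only [Pi.add_apply, Pi.smul_apply, smul_eq_mul, Finset.sum_add_distrib,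
      ← Finset.mul_sum, h1, h2, mul_one, hab]

open Classical in
theorem single_mem_geomRealOn {x : X} (hx : x ∈ S) : (Pi.single x 1 : X → ℝ) ∈ geomRealOn S := by
  have h := support_single_one x
  refine ⟨fun y => ?_, ?_, ?_, {x}, ?_, ?_⟩
  · by_cases hy : y = x <;> simp [hy]
  · rw [h]
    simpa using hx
  · rw [h]
    exact Set.subsingleton_singleton.isChain
  · rw [h]
    simp
  · simp

/-- The open star of a vertex in the geometric realization. -/
def openStar (x : S) : Set (geomRealOn S) := {f | 0 < f.1 x}

theorem isOpen_openStar (x : S) : IsOpen (openStar x) :=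
  isOpen_lt continuous_const ((continuous_apply (x : X)).comp continuous_subtype_val)

theorem exists_mem_openStar (f : geomRealOn S) : ∃ x : S, f ∈ openStar x := by
  obtain ⟨f, hf0, hfS, -, s, hs, hs1⟩ := f
  by_contra! h
  have : ∑ x ∈ s, f x = 0 := Finset.sum_eq_zero fun x _ => by
    by_contra hne
    exact h ⟨x, hfS hne⟩ (lt_of_le_of_ne (hf0 x) (Ne.symm hne))
  rw [this] at hs1
  exact zero_ne_one hs1

theorem comparable_of_mem_openStar {x y : S} {f : geomRealOn S} (hx : f ∈ openStar x)
    (hy : f ∈ openStar y) : x ≤ y ∨ y ≤ x :=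
  f.2.2.2.1.total (ne_of_gt hx : f.1 x ≠ 0) (ne_of_gt hy : f.1 y ≠ 0)

/-- A set of points of the realization containing a point `v` with all small supports is
star-shaped about `v`. -/
theorem starConvex_of_support_subset {T : Set X} {v : X → ℝ} (hv : v ∈ geomRealOn S)
    (hT : support v = T) :
    StarConvex ℝ v (Subtype.val '' {f : geomRealOn S | ∀ x ∈ T, 0 < f.1 x}) := by
  rintro _ ⟨f, hf, rfl⟩ a b ha hb hab
  have hsub : support v ⊆ support f.1 := fun x hx => (hf x (hT ▸ hx)).ne'
  refine ⟨⟨a • v + b • f.1, combo_mem_geomRealOn hv f.2 ?_ ha hb hab⟩, fun x hx => ?_, rfl⟩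
  · rw [Set.union_eq_self_of_subset_left hsub]
    exact f.2.2.2.1
  · have h1 : 0 < v x := lt_of_le_of_ne (hv.1 x) (Ne.symm (hT.symm ▸ hx : x ∈ support v))
    have h2 := hf x hx
    change 0 < a * v x + b * f.1 x
    rcases ha.lt_or_eq with h | h
    · positivity
    · have : b = 1 := by linarith
      rw [← h, this]
      linarith

open Classical in
theorem isSimplyConnected_openStar (x : S) : IsSimplyConnected (openStar x) := by
  have h := starConvex_of_support_subset (T := {(x : X)}) (single_mem_geomRealOn x.2) (by simp)
  have he : {f : geomRealOn S | ∀ y ∈ ({(x : X)} : Set X), 0 < f.1 y} = openStar x := by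
    ext f
    simp [openStar]
  rw [he] at h
  have hne : (openStar x).Nonempty := ⟨⟨_, single_mem_geomRealOn x.2⟩, by simp [openStar]⟩
  have := h.contractibleSpace (hne.image _)
  have := ((Topology.IsEmbedding.subtypeVal (p := (· ∈ geomRealOn S))).homeomorphImage
    (openStar x)).contractibleSpace
  exact SimplyConnectedSpace.ofContractible (openStar x)

open Classical in
/-- The midpoint of two comparable vertices. -/
theorem exists_midpoint {x y : X} (hx : x ∈ S) (hy : y ∈ S) (hxy : x ≤ y ∨ y ≤ x) :
    ∃ v ∈ geomRealOn S, support v = {x, y} := by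
  refine ⟨_, combo_mem_geomRealOn (single_mem_geomRealOn hx) (single_mem_geomRealOn hy) ?_
    one_half_pos.le one_half_pos.le (add_halves 1), ?_⟩
  · simp only [support_single_one, Set.singleton_union]
    rw [IsChain, Set.pairwise_pair]
    intro _
    exact ⟨hxy, hxy.symm⟩
  · ext z
    by_cases h1 : z = x <;> by_cases h2 : z = y <;>
      simp [Pi.single_apply, h1, h2, mem_support] <;> norm_num <;> aesop

theorem isPathConnected_openStar_inter {x y : S} (h : (openStar x ∩ openStar y).Nonempty) :
    IsPathConnected (openStar x ∩ openStar y) := by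
  obtain ⟨f, hf⟩ := h
  obtain ⟨v, hv, hvs⟩ := exists_midpoint x.2 y.2 (comparable_of_mem_openStar hf.1 hf.2)
  have h := starConvex_of_support_subset hv hvs
  have he : {f : geomRealOn S | ∀ z ∈ ({(x : X), (y : X)} : Set X), 0 < f.1 z} =
      openStar x ∩ openStar y := by
    ext f
    simp [openStar]
  rw [he] at h
  rw [Topology.IsInducing.subtypeVal.isPathConnected_iff]
  exact h.isPathConnected ⟨⟨v, hv⟩, he ▸ fun z hz => lt_of_le_of_ne (hv.1 z)
    (Ne.symm (hvs ▸ hz : z ∈ support v)), rfl⟩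

open Classical in
theorem openStar_inter_nonempty {x y z : S} (hxy : x ≤ y) (hyz : y ≤ z) :
    (openStar x ∩ openStar y ∩ openStar z).Nonempty := by
  obtain ⟨v, hv, hvs⟩ := exists_midpoint x.2 y.2 (Or.inl hxy)
  have hz : z.1 ∈ S := z.2
  refine ⟨⟨_, combo_mem_geomRealOn hv (single_mem_geomRealOn hz) ?_ one_half_pos.le
    one_half_pos.le (add_halves 1)⟩, ?_⟩
  · rw [hvs, support_single_one, Set.union_singleton]
    have h1 : (x : X) ≤ y := hxy
    have h2 : (y : X) ≤ z := hyz
    have h3 := h1.trans h2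
    intro a ha b hb _
    simp only [Set.mem_insert_iff, Set.mem_singleton_iff] at ha hb
    rcases ha with rfl | rfl | rfl <;> rcases hb with rfl | rfl | rfl <;> simp [h1, h2, h3]
  · have h0 := hv.1
    have hvx : 0 < v x := lt_of_le_of_ne (h0 _) (Ne.symm (by rw [← mem_support, hvs]; simp))
    have hvy : 0 < v y := lt_of_le_of_ne (h0 _) (Ne.symm (by rw [← mem_support, hvs]; simp))
    have hs0 : ∀ w, 0 ≤ (Pi.single (z : X) (1 : ℝ) : X → ℝ) w :=
      (single_mem_geomRealOn hz).1
    refine ⟨⟨?_, ?_⟩, ?_⟩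
    · exact add_pos_of_pos_of_nonneg (mul_pos one_half_pos hvx) (mul_nonneg one_half_pos.le (hs0 _))
    · exact add_pos_of_pos_of_nonneg (mul_pos one_half_pos hvy) (mul_nonneg one_half_pos.le (hs0 _))
    · refine add_pos_of_nonneg_of_pos (mul_nonneg one_half_pos.le (h0 _)) ?_
      simp

theorem IsPosetCocycle.eq_inv {P H : Type} [Preorder P] [Group H] {c : P → P → H}
    (hc : IsPosetCocycle c) {x y : P} (hxy : x ≤ y) (hyx : y ≤ x) : c x y = (c y x)⁻¹ := by
  rw [eq_inv_iff_mul_eq_one, hc x y x hxy hyx, hc.self]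

theorem isFreeGroup_fundamentalGroup_geomRealOn (h : HasCocycleLifting S) (x₀ : geomRealOn S) :
    IsFreeGroup (FundamentalGroup (geomRealOn S) x₀) := by
  classical
  refine isFreeGroup_fundamentalGroup_of_lift (U := openStar (S := S)) isOpen_openStar
    exists_mem_openStar isSimplyConnected_openStar
    (fun _ _ h => isPathConnected_openStar_inter h) ?_ x₀
  intro H E _ _ q hq c hc
  have hcp : IsPosetCocycle c := fun x y z hxy hyz => hc x y z (openStar_inter_nonempty hxy hyz)
  obtain ⟨d, hd, hqd⟩ := h H E q hq c hcp
  let d' : S → S → E := fun x y => if x ≤ y then d x y else (d y x)⁻¹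
  have hd1 : ∀ {x y}, x ≤ y → d' x y = d x y := fun h => if_pos h
  have hd2 : ∀ {x y}, y ≤ x → d' x y = (d y x)⁻¹ := fun {x y} h => by
    by_cases h' : x ≤ y
    · rw [hd1 h', hd.eq_inv h' h]
    · exact if_neg h'
  refine ⟨d', ?_, ?_⟩
  · rintro x y z ⟨f, ⟨hx, hy⟩, hz⟩
    rcases comparable_of_mem_openStar hx hy with hxy | hxy <;>
    rcases comparable_of_mem_openStar hy hz with hyz | hyz
    · rw [hd1 hxy, hd1 hyz, hd1 (hxy.trans hyz), hd x y z hxy hyz]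
    · rcases comparable_of_mem_openStar hx hz with hxz | hxz
      · rw [hd1 hxy, hd2 hyz, hd1 hxz, ← hd x z y hxz hyz, mul_inv_cancel_right]
      · rw [hd1 hxy, hd2 hyz, hd2 hxz, ← hd z x y hxz hxy]
        group
    · rcases comparable_of_mem_openStar hx hz with hxz | hxz
      · rw [hd2 hxy, hd1 hyz, hd1 hxz, ← hd y x z hxy hxz, inv_mul_cancel_left]
      · rw [hd2 hxy, hd1 hyz, hd2 hxz, ← hd y z x hyz hxz]
        group
    · rw [hd2 hxy, hd2 hyz, hd2 (hyz.trans hxy), ← mul_inv_rev, hd z y x hyz hxy]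
  · rintro x y ⟨f, hx, hy⟩
    rcases comparable_of_mem_openStar hx hy with hxy | hxy
    · rw [hd1 hxy, hqd _ _ hxy]
    · have := hc x y x ⟨f, ⟨hx, hy⟩, hx⟩
      rw [hcp.self, mul_eq_one_iff_eq_inv] at this
      rw [hd2 hxy, map_inv, hqd _ _ hxy, this]

end GeometricRealization

section CocycleLifting

variable {X Y : Type} {H E : Type} [Group H] [Group E]

/-- Every cocycle on a conically contractible poset is a coboundary: here `D` is antitone with
values below `n`, and elements below `D a` have a least upper bound with `a`. -/
theorem exists_primitive_of_antitone [PartialOrder X] {c : X → X → H} (hc : IsPosetCocycle c)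
    (n : X) (D : X → X) (hD : Antitone D) (hn : ∀ a, D a ≤ n)
    (hJ : ∀ a d, d ≤ D a → ∃ j, IsLUB {a, d} j) :
    ∃ h : X → H, ∀ a b, a ≤ b → c a b = h a * (h b)⁻¹ := by
  choose! J hJ using hJ
  have h1 : ∀ {a d}, d ≤ D a → a ≤ J a d := fun h => (hJ _ _ h).1 (by simp)
  have h2 : ∀ {a d}, d ≤ D a → d ≤ J a d := fun h => (hJ _ _ h).1 (by simp)
  have h3 : ∀ {a d j}, d ≤ D a → a ≤ j → d ≤ j → J a d ≤ j := fun h ha hd =>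
    (hJ _ _ h).2 (by simp [upperBounds, ha, hd])
  let F : X → X → H := fun a d => c a (J a d) * (c d (J a d))⁻¹ * c d n
  have hF : ∀ a d, d ≤ D a → F a d = F a (D a) := by
    intro a d hd
    have hle : J a d ≤ J a (D a) := h3 hd (h1 le_rfl) (hd.trans (h2 le_rfl))
    simp only [F]
    rw [← hc a _ _ (h1 hd) hle, ← hc d _ n hd (hn a)]
    have := (hc d _ _ (h2 hd) hle).trans (hc d _ _ hd (h2 le_rfl)).symm
    rw [← eq_inv_mul_iff_mul_eq] at this
    rw [this]
    group
  refine ⟨fun a => F a (D a), fun a b hab => ?_⟩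
  simp only [← hF a (D b) (hD hab), eq_mul_inv_iff_mul_eq]
  have hle : J a (D b) ≤ J b (D b) := h3 (hD hab) (hab.trans (h1 le_rfl)) (h2 le_rfl)
  simp only [F]
  rw [← mul_assoc, ← mul_assoc, hc a b _ hab (h1 le_rfl), ← hc a _ _ (h1 (hD hab)) hle,
    ← hc (D b) _ _ (h2 (hD hab)) hle]
  group

theorem exists_lift_of_primitive [Preorder X] {q : E →* H} (hq : Surjective q) {c : X → X → H}
    {h : X → H} (hch : ∀ a b, a ≤ b → c a b = h a * (h b)⁻¹) :
    ∃ d : X → X → E, IsPosetCocycle d ∧ ∀ x y, x ≤ y → q (d x y) = c x y := by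
  refine ⟨fun a b => surjInv hq (h a) * (surjInv hq (h b))⁻¹, fun _ _ _ _ _ => by group, ?_⟩
  intro x y hxy
  rw [map_mul, map_inv, surjInv_eq hq, surjInv_eq hq, hch x y hxy]

/-- To lift cocycles one may assume that they vanish on pairs whose larger element belongs to
an upper set `T` of elements above which only minimal elements lie. -/
theorem hasCocycleLifting_of_vanishing [PartialOrder X] (T : X → Prop)
    (hT : ∀ x y, T x → x ≤ y → T y) (hmin : ∀ x y z, T z → y < z → x ≤ y → x = y)
    (h : ∀ (H E : Type) [Group H] [Group E] (q : E →* H), Surjective q → ∀ c : X → X → H,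
      IsPosetCocycle c → (∀ x y, T y → c x y = 1) →
      ∃ d : X → X → E, IsPosetCocycle d ∧ ∀ x y, x ≤ y → q (d x y) = c x y) :
    HasCocycleLifting X := by
  classical
  intro H E _ _ q hq c hc
  have hc' : IsPosetCocycle fun x y => if T y then 1 else c x y := by
    intro x y z hxy hyz
    by_cases hz : T z
    · rcases hyz.eq_or_lt with rfl | hlt
      · simp [hz]
      · obtain rfl := hmin x y z hz hlt hxy
        simp [hz, hc.self]
    · have hy : ¬ T y := fun hy => hz (hT y z hy hyz)
      simp only [hz, hy, if_false]
      exact hc x y z hxy hyz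
  obtain ⟨d, hd, hqd⟩ := h H E q hq _ hc' fun x y hy => if_pos hy
  refine ⟨fun x y => if T y then (if x = y then 1 else surjInv hq (c x y)) else d x y, ?_, ?_⟩
  · intro x y z hxy hyz
    by_cases hz : T z
    · rcases hyz.eq_or_lt with rfl | hlt
      · simp [hz]
      · obtain rfl := hmin x y z hz hlt hxy
        simp [hz, hd.self]
    · have hy : ¬ T y := fun hy => hz (hT y z hy hyz)
      simp only [hz, hy, if_false]
      exact hd x y z hxy hyz
  · intro x y hxy
    by_cases hy : T y
    · by_cases he : x = y
      · simp [he, hy, hc.self]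
      · simp [hy, he, surjInv_eq]
    · simpa [hy] using hqd x y hxy

/-- Lifting of a cocycle along a monotone map `f : X → Y` with connected, cohomologically
trivial fibres over a set of big elements of `Y`, all other elements being minimal. -/
theorem exists_lift_of_fibration [PartialOrder X] [PartialOrder Y] {f : X → Y} (hf : Monotone f)
    (hY : HasCocycleLifting Y) (Big : Y → Prop)
    (hXmin : ∀ x w, x ≤ w → ¬ Big (f w) → x = w) (hYmin : ∀ y z, y ≤ z → ¬ Big z → y = z)
    (σ : Y → X) (hσ : ∀ y, f (σ y) ≤ y)
    (hconn : ∀ y, Big y → ∀ φ : X → H, (∀ x x', x ≤ x' → f x' ≤ y → φ x = φ x') →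
      ∀ x x', f x ≤ y → f x' ≤ y → φ x = φ x')
    {q : E →* H} (hq : Surjective q) {c : X → X → H} (hc : IsPosetCocycle c)
    (hcob : ∀ y, Big y → ∃ g : X → H, ∀ x x', x ≤ x' → f x' ≤ y → c x x' = g x * (g x')⁻¹) :
    ∃ d : X → X → E, IsPosetCocycle d ∧ ∀ x y, x ≤ y → q (d x y) = c x y := by
  classical
  have hup : ∀ {y z}, Big y → y ≤ z → Big z := fun {y z} hy hyz => by
    by_contra hz
    exact hz (hYmin y z hyz hz ▸ hy)
  choose! g' hg' using hcob
  let g : Y → X → H := fun y => if Big y then g' y else 1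
  have hg : ∀ y, Big y → ∀ x x', x ≤ x' → f x' ≤ y → c x x' = g y x * (g y x')⁻¹ := by
    intro y hy
    simp only [g, if_pos hy]
    exact hg' y hy
  have htrans : ∀ {y z}, Big y → y ≤ z → ∀ x x', f x ≤ y → f x' ≤ y →
      (g y x)⁻¹ * g z x = (g y x')⁻¹ * g z x' := by
    intro y z hy hyz
    refine hconn y hy (fun x => (g y x)⁻¹ * g z x) fun x x' hxx' hx' => ?_
    have h1 := hg y hy x x' hxx' hx'
    have h2 := hg z (hup hy hyz) x x' hxx' (hx'.trans hyz)
    rw [eq_mul_inv_iff_mul_eq] at h1 h2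
    simp only [← h1, ← h2]
    group
  let d : Y → Y → H := fun y z => (g y (σ y))⁻¹ * g z (σ y)
  have hd : IsPosetCocycle d := by
    intro y₁ y₂ y₃ h12 h23
    by_cases h2 : Big y₂
    · simp only [d]
      rw [htrans h2 h23 (σ y₂) (σ y₁) (hσ _) ((hσ _).trans h12)]
      group
    · obtain rfl := hYmin _ _ h12 h2
      simp [d]
  obtain ⟨d', hd', hqd⟩ := hY H E q hq d hd
  let K : X → Y → H := fun x z => g z x * (g z (σ (f x)))⁻¹ * g (f x) (σ (f x))
  have hK : ∀ x y z, Big y → f x ≤ y → y ≤ z → K x y = K x z := by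
    intro x y z hy hxy hyz
    have := htrans hy hyz x (σ (f x)) hxy ((hσ _).trans hxy)
    simp only [K]
    rw [inv_mul_eq_iff_eq_mul] at this
    rw [this]
    group
  let K' : X → Y → E := fun x z => surjInv hq (K x z)
  have hK' : ∀ x y z, Big y → f x ≤ y → y ≤ z → K' x y = K' x z := fun x y z hy hxy hyz =>
    congrArg (surjInv hq) (hK x y z hy hxy hyz)
  refine ⟨fun x w => K' x (f w) * d' (f x) (f w) * (K' w (f w))⁻¹, ?_, ?_⟩
  · intro x w v hxw hwv
    by_cases hw : Big (f w)
    · simp only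
      rw [hK' x (f w) (f v) hw (hf hxw) (hf hwv), hK' w (f w) (f v) hw le_rfl (hf hwv),
        ← hd' _ _ _ (hf hxw) (hf hwv)]
      group
    · obtain rfl := hXmin x w hxw hw
      simp [hd'.self]
  · intro x w hxw
    simp only [map_mul, map_inv, hqd _ _ (hf hxw), K', surjInv_eq]
    by_cases hw : Big (f w)
    · rw [hg _ hw x w hxw le_rfl]
      simp only [K, d]
      group
    · obtain rfl := hXmin x w hxw hw
      simp [hc.self, hd.self]

end CocycleLifting

section Coprime

open Finset

theorem exists_pow_pow_eq_self {M : Type} [CommGroup M] [Finite M] {p : ℕ}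
    (hcop : (Nat.card M).Coprime p) : ∃ r : ℕ, ∀ m : M, (m ^ r) ^ p = m := by
  by_cases h1 : Nat.card M = 1
  · have : Subsingleton M := (Nat.card_eq_one_iff_unique.1 h1).1
    exact ⟨0, fun m => Subsingleton.elim _ _⟩
  · have h2 : 1 < Nat.card M := lt_of_le_of_ne Nat.card_pos (Ne.symm h1)
    obtain ⟨r, -, hr⟩ := Nat.exists_mul_mod_eq_one_of_coprime hcop.symm h2
    refine ⟨r, fun m => ?_⟩
    rw [← pow_mul, mul_comm, ← pow_mod_natCard, hr, pow_one]

variable {M A : Type} [CommGroup M] [CommGroup A] (ρ : A →* MulAut M) (p : ℕ)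

/-- The subgroup of elements fixed by one element of an acting group. -/
def fixedSubgroup (a : A) : Subgroup M where
  carrier := {m | ρ a m = m}
  mul_mem' {x y} hx hy := by
    simp only [Set.mem_ofPred_eq] at hx hy ⊢
    rw [map_mul, hx, hy]
  one_mem' := map_one _
  inv_mem' {x} hx := by
    simp only [Set.mem_ofPred_eq] at hx ⊢
    rw [map_inv, hx]

variable {ρ}

theorem mem_fixedSubgroup {a : A} {m : M} : m ∈ fixedSubgroup ρ a ↔ ρ a m = m := Iff.rfl

theorem map_mem_fixedSubgroup {a : A} {m : M} (b : A) (hm : m ∈ fixedSubgroup ρ a) :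
    ρ b m ∈ fixedSubgroup ρ a := by
  rw [mem_fixedSubgroup] at hm ⊢
  rw [← MulAut.mul_apply, ← map_mul, mul_comm, map_mul, MulAut.mul_apply, hm]

theorem fixedSubgroup_inf_le_mul_pow (a b : A) (i : ℕ) :
    fixedSubgroup ρ a ⊓ fixedSubgroup ρ b ≤ fixedSubgroup ρ (a * b ^ i) := by
  rintro m ⟨ha, hb⟩
  have hbi : ρ (b ^ i) m = m := by
    induction i with
    | zero => simp
    | succ i ih => rw [pow_succ, map_mul, MulAut.mul_apply, mem_fixedSubgroup.1 hb, ih]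
  rw [mem_fixedSubgroup, map_mul, MulAut.mul_apply, hbi]
  exact ha

variable (ρ)

/-- The product of the translates of an element under the powers of `x` with exponent `< p`. -/
def orbitNorm (x : A) : M →* M := ∏ j ∈ range p, (ρ (x ^ j)).toMonoidHom

variable {ρ p}

theorem orbitNorm_apply (x : A) (m : M) : orbitNorm ρ p x m = ∏ j ∈ range p, ρ (x ^ j) m := by
  simp [orbitNorm]

theorem orbitNorm_mem_fixedSubgroup {x : A} (hx : x ^ p = 1) (m : M) :
    orbitNorm ρ p x m ∈ fixedSubgroup ρ x := by
  rw [mem_fixedSubgroup, orbitNorm_apply, map_prod]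
  have h1 : ∀ j, ρ x (ρ (x ^ j) m) = ρ (x ^ (j + 1)) m := fun j => by
    rw [pow_succ', map_mul, MulAut.mul_apply]
  simp only [h1]
  have h2 := prod_range_succ' (fun j => ρ (x ^ j) m) p
  rw [prod_range_succ, hx, pow_zero] at h2
  exact (mul_right_cancel h2).symm

theorem orbitNorm_mem {T : Subgroup M} (hT : ∀ a, ∀ m ∈ T, ρ a m ∈ T) (x : A) {m : M}
    (hm : m ∈ T) : orbitNorm ρ p x m ∈ T := by
  rw [orbitNorm_apply]
  exact T.prod_mem fun j _ => hT _ _ hm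

theorem prod_orbitNorm (hp : p.Prime) {a b : A} (hb : b ^ p = 1) (m : M) :
    ∏ i ∈ range p, orbitNorm ρ p (a * b ^ i) m =
      m ^ p * ∏ j ∈ Ico 1 p, ρ (a ^ j) (orbitNorm ρ p b m) := by
  simp only [orbitNorm_apply]
  rw [prod_comm, prod_range_eq_mul_Ico _ hp.pos]
  congr 1
  · simp
  refine prod_congr rfl fun j hj => ?_
  rw [mem_Ico] at hj
  have hcop : p.Coprime j := (Nat.Prime.coprime_iff_not_dvd hp).2 fun h =>
    absurd (Nat.le_of_dvd (by lia) h) (by lia)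
  rw [map_prod]
  have h1 : ∀ i, ρ ((a * b ^ i) ^ j) m = ρ (a ^ j) (ρ (b ^ (i * j % p)) m) := fun i => by
    rw [← MulAut.mul_apply, ← map_mul, mul_pow, ← pow_mul, ← pow_mod_orderOf b (i * j % p),
      Nat.mod_mod_of_dvd _ (orderOf_dvd_of_pow_eq_one hb), pow_mod_orderOf]
  simp only [h1]
  have hmaps : ∀ i ∈ range p, i * j % p ∈ range p := fun i _ => mem_range.2 (Nat.mod_lt _ hp.pos)
  have hinj : Set.InjOn (fun i => i * j % p) (range p) := by
    intro i hi i' hi' h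
    rw [mem_coe, mem_range] at hi hi'
    exact (Nat.ModEq.cancel_right_of_coprime hcop h).eq_of_lt_of_lt hi hi'
  exact prod_nbij (fun i => i * j % p) hmaps hinj
    (surjOn_of_injOn_of_card_le _ hmaps hinj le_rfl) fun _ _ => rfl

theorem mul_pow_ne_one (hp : p.Prime) (hA : ∀ a : A, a ^ p = 1) {x y : A}
    (hxy : ∀ i : ℕ, x ≠ y ^ i) (i : ℕ) : x * y ^ i ≠ 1 := by
  intro h
  refine hxy (i * (p - 1)) ?_
  have h1 : y ^ (i * (p - 1)) * y ^ i = 1 := by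
    rw [← pow_add, ← Nat.mul_succ, Nat.succ_eq_add_one, Nat.sub_add_cancel hp.one_le, pow_mul, hA]
  rw [eq_inv_of_mul_eq_one_left h, eq_inv_of_mul_eq_one_left h1]

/-- An invariant subgroup is generated by the fixed points in it of the nontrivial elements
`a * b ^ i` and `b` of a rank two group of coprime exponent. -/
theorem le_of_inf_fixedSubgroup_le [Finite M] (hp : p.Prime) (hcop : (Nat.card M).Coprime p)
    (hA : ∀ a : A, a ^ p = 1) {S T : Subgroup M} (hT : ∀ a, ∀ m ∈ T, ρ a m ∈ T) (a b : A)
    (h1 : ∀ i, T ⊓ fixedSubgroup ρ (a * b ^ i) ≤ S) (h2 : T ⊓ fixedSubgroup ρ b ≤ S) : T ≤ S := by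
  intro m hm
  obtain ⟨r, hr⟩ := exists_pow_pow_eq_self hcop
  have hmr : m ^ r ∈ T := T.pow_mem hm r
  rw [← hr m, ← mul_inv_cancel_right ((m ^ r) ^ p)
    (∏ j ∈ Ico 1 p, ρ (a ^ j) (orbitNorm ρ p b (m ^ r))), ← prod_orbitNorm hp (hA b)]
  refine S.mul_mem (S.prod_mem fun i _ => h1 i ⟨orbitNorm_mem hT _ hmr,
    orbitNorm_mem_fixedSubgroup (hA _) _⟩) (S.inv_mem (S.prod_mem fun j _ => h2
      ⟨hT _ _ (orbitNorm_mem hT _ hmr), ?_⟩))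
  exact map_mem_fixedSubgroup _ (orbitNorm_mem_fixedSubgroup (hA _) _)

/-- Compatible homomorphisms from the fixed point subgroups of the nontrivial elements to an
abelian group extend to the whole group. -/
theorem exists_monoidHom_extending [Finite M] (hp : p.Prime) (hcop : (Nat.card M).Coprime p)
    (hA : ∀ a : A, a ^ p = 1) {a b : A} (hb : b ≠ 1) (hab : ∀ i : ℕ, a * b ^ i ≠ 1)
    {N : Type} [CommGroup N] (π : M → N) (hπ : ∀ e : A, e ≠ 1 → ∀ k ∈ fixedSubgroup ρ e,
      ∀ l ∈ fixedSubgroup ρ e, π (k * l) = π k * π l) :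
    ∃ Ψ : M →* N, ∀ e : A, e ≠ 1 → ∀ k ∈ fixedSubgroup ρ e, Ψ k = π k := by
  have hπ1 : ∀ e : A, e ≠ 1 → ∃ φ : fixedSubgroup ρ e →* N, ∀ k, φ k = π k := fun e he =>
    ⟨MonoidHom.mk' (fun k => π k) fun k l => hπ e he k k.2 l l.2, fun _ => rfl⟩
  choose! φ hφ using hπ1
  obtain ⟨r, hr⟩ := exists_pow_pow_eq_self hcop
  have hN : ∀ i m, orbitNorm ρ p (a * b ^ i) m ∈ fixedSubgroup ρ (a * b ^ i) :=
    fun i m => orbitNorm_mem_fixedSubgroup (hA _) _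
  have hNb : ∀ j m, ρ (a ^ j) (orbitNorm ρ p b m) ∈ fixedSubgroup ρ b :=
    fun j m => map_mem_fixedSubgroup _ (orbitNorm_mem_fixedSubgroup (hA _) _)
  let Ψ : M → N := fun m => (∏ i ∈ range p, π (orbitNorm ρ p (a * b ^ i) (m ^ r))) *
    (∏ j ∈ Ico 1 p, π (ρ (a ^ j) (orbitNorm ρ p b (m ^ r))))⁻¹
  have hΨ : ∀ m n, Ψ (m * n) = Ψ m * Ψ n := by
    intro m n
    simp only [Ψ, mul_pow, map_mul]
    rw [prod_congr rfl fun i _ => hπ _ (hab i) _ (hN i (m ^ r)) _ (hN i (n ^ r)),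
      prod_congr (s₁ := Ico 1 p) rfl fun j _ => hπ _ hb _ (hNb j (m ^ r)) _ (hNb j (n ^ r)),
      prod_mul_distrib, prod_mul_distrib, mul_inv]
    exact mul_mul_mul_comm _ _ _ _
  refine ⟨MonoidHom.mk' Ψ hΨ, fun e he k hk => ?_⟩
  have hT : ∀ x, ∀ m ∈ fixedSubgroup ρ e, ρ x m ∈ fixedSubgroup ρ e :=
    fun x m hm => map_mem_fixedSubgroup x hm
  have hkr : k ^ r ∈ fixedSubgroup ρ e := Subgroup.pow_mem _ hk r
  have hprod : ∀ (s : Finset ℕ) (F : ℕ → M), (∀ i, F i ∈ fixedSubgroup ρ e) →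
      ∏ i ∈ s, π (F i) = π (∏ i ∈ s, F i) := by
    intro s F hF
    have := map_prod (φ e) (fun i => (⟨F i, hF i⟩ : fixedSubgroup ρ e)) s
    simp only [hφ e he, Subgroup.val_finsetProd] at this
    exact this.symm
  change Ψ k = π k
  simp only [Ψ]
  rw [hprod _ _ fun i => orbitNorm_mem hT _ hkr, hprod _ _ fun j => hT _ _ (orbitNorm_mem hT _ hkr),
    prod_orbitNorm hp (hA b), mul_inv_eq_iff_eq_mul, hr]
  exact hπ e he _ hk _ (Subgroup.prod_mem _ fun j _ => hT _ _ (orbitNorm_mem hT _ hkr))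

/-- Right translation by `k` on `M`, twisted by `u`. -/
def twistedTranslation {M H : Type} [Group M] [Group H] (u : M → M → H) (k : M) :
    Equiv.Perm (M × H) where
  toFun x := (x.1 * k, x.2 * u x.1 k)
  invFun x := (x.1 * k⁻¹, x.2 * (u (x.1 * k⁻¹) k)⁻¹)
  left_inv x := by simp
  right_inv x := by simp

open scoped IsMulCommutative in
/-- A twisted translation datum which is multiplicative along the fixed points of each
nontrivial element of a group of rank at least three is a coboundary. -/
theorem exists_primitive_of_fixedSubgroup [Finite M] (hp : p.Prime)
    (hcop : (Nat.card M).Coprime p) (hA : ∀ a : A, a ^ p = 1)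
    (h2 : ∀ b : A, ∃ a, ∀ i : ℕ, a ≠ b ^ i) (h3 : ∀ b y : A, ∃ x, ∀ i j : ℕ, x ≠ b ^ i * y ^ j)
    {H : Type} [Group H] (u : M → M → H)
    (hu : ∀ e : A, e ≠ 1 → ∀ k ∈ fixedSubgroup ρ e, ∀ l ∈ fixedSubgroup ρ e, ∀ m,
      u m k * u (m * k) l = u m (k * l)) :
    ∃ s : M → H, ∀ m, ∀ e : A, e ≠ 1 → ∀ k ∈ fixedSubgroup ρ e, s (m * k) = s m * u m k := by
  classical
  let π := twistedTranslation u
  have hπ : ∀ e : A, e ≠ 1 → ∀ k ∈ fixedSubgroup ρ e, ∀ l ∈ fixedSubgroup ρ e,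
      π (k * l) = π k * π l := by
    intro e he k hk l hl
    rw [mul_comm]
    ext x : 1
    simp [π, twistedTranslation, mul_assoc, ← hu e he l hl k hk]
  have hπc : ∀ e : A, e ≠ 1 → ∀ k ∈ fixedSubgroup ρ e, ∀ l ∈ fixedSubgroup ρ e,
      Commute (π k) (π l) := fun e he k hk l hl => by
    rw [Commute, SemiconjBy, ← hπ e he k hk l hl, ← hπ e he l hl k hk, mul_comm]
  -- the elements of a fixed point subgroup whose translation commutes with a given permutation
  have hcent : ∀ e : A, e ≠ 1 → ∀ P : Equiv.Perm (M × H), ∃ S : Subgroup M, ∀ m,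
      m ∈ S ↔ m ∈ fixedSubgroup ρ e ∧ Commute (π m) P := by
    intro e he P
    let φ : fixedSubgroup ρ e →* Equiv.Perm (M × H) :=
      MonoidHom.mk' (fun k => π k) fun k l => hπ e he k k.2 l l.2
    refine ⟨((Subgroup.centralizer {P}).comap φ).map (fixedSubgroup ρ e).subtype, fun m => ?_⟩
    simp only [Subgroup.mem_map, Subgroup.mem_comap, Subgroup.mem_centralizer_singleton_iff]
    constructor
    · rintro ⟨k, hk, rfl⟩
      exact ⟨k.2, hk⟩
    · rintro ⟨hm, hm'⟩
      exact ⟨⟨m, hm⟩, hm', rfl⟩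
  have hinv : ∀ e : A, ∀ a, ∀ m ∈ fixedSubgroup ρ e, ρ a m ∈ fixedSubgroup ρ e :=
    fun e a m hm => map_mem_fixedSubgroup a hm
  have hone : ∀ x y : A, (∀ i : ℕ, x ≠ y ^ i) → ∀ i : ℕ, x * y ^ i ≠ 1 :=
    fun x y => mul_pow_ne_one hp hA
  have hcomm_of_ne_pow : ∀ b b' a : A, a ≠ 1 → b' ≠ 1 → (∀ i : ℕ, b ≠ b' ^ i) →
      ∀ k ∈ fixedSubgroup ρ b ⊓ fixedSubgroup ρ b', ∀ l ∈ fixedSubgroup ρ a,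
      Commute (π l) (π k) := by
    intro b b' a ha hb' hbb' k hk l hl
    obtain ⟨S, hS⟩ := hcent a ha (π k)
    have hle : fixedSubgroup ρ a ≤ S := by
      refine le_of_inf_fixedSubgroup_le hp hcop hA (hinv a) b b' (fun i => ?_) ?_
      · exact fun m hm => (hS m).2 ⟨hm.1, hπc _ (hone _ _ hbb' i) _ hm.2 _
          (fixedSubgroup_inf_le_mul_pow b b' i hk)⟩
      · exact fun m hm => (hS m).2 ⟨hm.1, hπc b' hb' _ hm.2 _ hk.2⟩
    exact ((hS l).1 (hle hl)).2
  have hcomm_of_ne_one : ∀ a b : A, a ≠ 1 → b ≠ 1 → ∀ l ∈ fixedSubgroup ρ a,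
      ∀ k ∈ fixedSubgroup ρ b, Commute (π k) (π l) := by
    intro a b ha hb l hl k hk
    obtain ⟨y, hy⟩ := h2 b
    obtain ⟨x, hx⟩ := h3 b y
    obtain ⟨S, hS⟩ := hcent b hb (π l)
    have hle : fixedSubgroup ρ b ≤ S := by
      refine le_of_inf_fixedSubgroup_le hp hcop hA (hinv b) x y (fun i => ?_) ?_
      · refine fun m hm => (hS m).2 ⟨hm.1, (hcomm_of_ne_pow (x * y ^ i) b a ha hb (fun j h => ?_) m
          hm.symm l hl).symm⟩
        refine hx j (i * (p - 1)) ?_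
        have hi : i + i * (p - 1) = i * p := by
          have := Nat.le_mul_of_pos_right i hp.pos
          rw [Nat.mul_sub_one]
          lia
        rw [← h, mul_assoc, ← pow_add, hi, pow_mul, hA, mul_one]
      · exact fun m hm => (hS m).2 ⟨hm.1, (hcomm_of_ne_pow y b a ha hb hy m hm.symm l hl).symm⟩
    exact ((hS k).1 (hle hk)).2
  let Z : Set M := {k | ∃ e : A, e ≠ 1 ∧ k ∈ fixedSubgroup ρ e}
  have hcomm : ∀ P ∈ π '' Z, ∀ Q ∈ π '' Z, P * Q = Q * P := by
    rintro _ ⟨k, ⟨b, hb, hk⟩, rfl⟩ _ ⟨l, ⟨a, ha, hl⟩, rfl⟩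
    exact hcomm_of_ne_one a b ha hb l hl k hk
  have := Subgroup.isMulCommutative_closure hcomm
  have hmem : ∀ k ∈ Z, π k ∈ Subgroup.closure (π '' Z) := fun k hk =>
    Subgroup.subset_closure ⟨k, hk, rfl⟩
  let π' : M → Subgroup.closure (π '' Z) := fun k => if h : k ∈ Z then ⟨π k, hmem k h⟩ else 1
  have hπ'e : ∀ e : A, e ≠ 1 → ∀ k ∈ fixedSubgroup ρ e, (π' k : Equiv.Perm (M × H)) = π k := by
    intro e he k hk
    simp only [π', dif_pos (show k ∈ Z from ⟨e, he, hk⟩)]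
  obtain ⟨b, hb⟩ := h2 1
  have hb1 : b ≠ 1 := by simpa using hb 0
  obtain ⟨a, hab⟩ := h2 b
  obtain ⟨Ψ, hΨ⟩ := exists_monoidHom_extending hp hcop hA hb1 (hone a b hab) π' (by
    intro e he k hk l hl
    ext1
    rw [Subgroup.coe_mul, hπ'e e he k hk, hπ'e e he l hl, hπ'e e he _ (mul_mem hk hl),
      hπ e he k hk l hl])
  have hΨe : ∀ e : A, e ≠ 1 → ∀ k ∈ fixedSubgroup ρ e, (Ψ k : Equiv.Perm (M × H)) = π k := by
    intro e he k hk
    rw [hΨ e he k hk, hπ'e e he k hk]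
  let S : Subgroup M :=
    { carrier := {m | ∀ x, ((Ψ m : Equiv.Perm (M × H)) x).1 = x.1 * m}
      mul_mem' := fun {m n} hm hn x => by
        rw [mul_comm, map_mul, Subgroup.coe_mul, Equiv.Perm.mul_apply, hn, hm, mul_assoc,
          mul_comm n]
      one_mem' := fun x => by simp
      inv_mem' := fun {m} hm x => by
        have := hm ((Ψ m⁻¹ : Equiv.Perm (M × H)) x)
        rw [← Equiv.Perm.mul_apply, ← Subgroup.coe_mul, ← map_mul] at this
        simp only [mul_inv_cancel, map_one, Subgroup.coe_one, Equiv.Perm.one_apply] at this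
        rw [this, mul_inv_cancel_right] }
  have hSe : ∀ e : A, e ≠ 1 → fixedSubgroup ρ e ≤ S := fun e he k hk x => by
    rw [hΨe e he k hk]
    rfl
  have hS : ∀ m, m ∈ S := fun m => (le_of_inf_fixedSubgroup_le (T := ⊤) hp hcop hA
    (fun _ _ _ => trivial) a b (fun i => inf_le_right.trans (hSe _ (hone a b hab i)))
    (inf_le_right.trans (hSe b hb1))) trivial
  refine ⟨fun m => ((Ψ m : Equiv.Perm (M × H)) (1, 1)).2, fun m e he k hk => ?_⟩
  have h1 := hS m (1, 1)
  simp only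
  rw [mul_comm m k, map_mul, Subgroup.coe_mul, Equiv.Perm.mul_apply, hΨe e he k hk]
  change _ * u _ k = _
  rw [h1, one_mul]

section Fibre

variable {X : Type} [PartialOrder X] {F : X → Prop} {P : M → X}

/-- A poset covered by cones under points `P m`, with `P m` and `P (m * k)` joined from below
whenever `k` is fixed by a nontrivial element of a rank two group, is connected. -/
theorem eq_of_locally_constant [Finite M] (hp : p.Prime) (hcop : (Nat.card M).Coprime p)
    (hA : ∀ a : A, a ^ p = 1) (h2 : ∀ b : A, ∃ a, ∀ i : ℕ, a ≠ b ^ i)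
    (hP : ∀ m, F (P m)) (hcover : ∀ x, F x → ∃ m, x ≤ P m)
    (hjoin : ∀ e : A, e ≠ 1 → ∀ m, ∃ x, ∀ k ∈ fixedSubgroup ρ e, x ≤ P (m * k))
    {Z : Type} (φ : X → Z) (hφ : ∀ x x', x ≤ x' → F x' → φ x = φ x')
    {x x' : X} (hx : F x) (hx' : F x') : φ x = φ x' := by
  let S : Subgroup M :=
    { carrier := {k | ∀ m, φ (P (m * k)) = φ (P m)}
      mul_mem' := fun {k l} hk hl m => by rw [← mul_assoc, hl, hk]
      one_mem' := fun m => by rw [mul_one]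
      inv_mem' := fun {k} hk m => by rw [← hk, inv_mul_cancel_right] }
  have hSe : ∀ e : A, e ≠ 1 → fixedSubgroup ρ e ≤ S := by
    intro e he k hk m
    obtain ⟨z, hz⟩ := hjoin e he m
    rw [← hφ z _ (hz k hk) (hP _)]
    have h1 := hz 1 (one_mem _)
    rw [mul_one] at h1
    exact hφ z _ h1 (hP _)
  obtain ⟨b, hb⟩ := h2 1
  have hb1 : b ≠ 1 := by simpa using hb 0
  obtain ⟨a, hab⟩ := h2 b
  have hS : ∀ m, m ∈ S := fun m => (le_of_inf_fixedSubgroup_le (T := ⊤) hp hcop hA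
    (fun _ _ _ => trivial) a b (fun i => inf_le_right.trans (hSe _ (mul_pow_ne_one hp hA hab i)))
    (inf_le_right.trans (hSe b hb1))) trivial
  have hconst : ∀ m n, φ (P m) = φ (P n) := fun m n => by
    have := hS (n⁻¹ * m) n
    rwa [mul_inv_cancel_left] at this
  obtain ⟨m, hm⟩ := hcover x hx
  obtain ⟨n, hn⟩ := hcover x' hx'
  rw [hφ x _ hm (hP m), hφ x' _ hn (hP n), hconst m n]

/-- A cocycle restricted to a poset covered by cones under points `P m` is a coboundary if cones
meet exactly when their tips differ by an element fixed by a nontrivial element of a group of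
rank at least three. -/
theorem exists_primitive_of_fibre [Finite M] (hp : p.Prime)
    (hcop : (Nat.card M).Coprime p) (hA : ∀ a : A, a ^ p = 1)
    (h2 : ∀ b : A, ∃ a, ∀ i : ℕ, a ≠ b ^ i) (h3 : ∀ b y : A, ∃ x, ∀ i j : ℕ, x ≠ b ^ i * y ^ j)
    (hF : ∀ x x', x ≤ x' → F x' → F x) (hcover : ∀ x, F x → ∃ m, x ≤ P m)
    (hjoin : ∀ e : A, e ≠ 1 → ∀ m, ∃ x, ∀ k ∈ fixedSubgroup ρ e, x ≤ P (m * k))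
    (hmeet : ∀ m n x, x ≤ P m → x ≤ P n → ∃ e : A, e ≠ 1 ∧ m⁻¹ * n ∈ fixedSubgroup ρ e)
    (hglb : ∀ m n x, x ≤ P m → x ≤ P n → ∃ z, IsGLB {P m, P n} z)
    {H : Type} [Group H] {c : X → X → H} (hc : IsPosetCocycle c) :
    ∃ g : X → H, ∀ x x', x ≤ x' → F x' → c x x' = g x * (g x')⁻¹ := by
  classical
  let u : M → M → H := fun m k =>
    if h : ∃ x, x ≤ P m ∧ x ≤ P (m * k) then (c h.choose (P m))⁻¹ * c h.choose (P (m * k)) else 1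
  have hu : ∀ m k x, x ≤ P m → x ≤ P (m * k) → u m k = (c x (P m))⁻¹ * c x (P (m * k)) := by
    intro m k x hx hx'
    have h : ∃ x, x ≤ P m ∧ x ≤ P (m * k) := ⟨x, hx, hx'⟩
    obtain ⟨z, hz⟩ := hglb m _ x hx hx'
    have hz1 : z ≤ P m := hz.1 (by simp)
    have hz2 : z ≤ P (m * k) := hz.1 (by simp)
    have key : ∀ w, w ≤ P m → w ≤ P (m * k) →
        (c w (P m))⁻¹ * c w (P (m * k)) = (c z (P m))⁻¹ * c z (P (m * k)) := by
      intro w hw hw'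
      have hwz : w ≤ z := hz.2 (by simp [lowerBounds, hw, hw'])
      rw [← hc w z _ hwz hz1, ← hc w z _ hwz hz2]
      group
    simp only [u, dif_pos h]
    rw [key x hx hx', key _ h.choose_spec.1 h.choose_spec.2]
  obtain ⟨s, hs⟩ := exists_primitive_of_fixedSubgroup hp hcop hA h2 h3 u (by
    intro e he k hk l hl m
    obtain ⟨x, hx⟩ := hjoin e he m
    have h0 := hx 1 (one_mem _)
    rw [mul_one] at h0
    have h1 := hx k hk
    have h2 := hx _ (mul_mem hk hl)
    rw [hu m k x h0 h1, hu m _ x h0 h2, hu (m * k) l x h1 (by rwa [mul_assoc]), ← mul_assoc m]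
    group)
  have hwd : ∀ m n x, x ≤ P m → x ≤ P n → c x (P m) * (s m)⁻¹ = c x (P n) * (s n)⁻¹ := by
    intro m n x hm hn
    obtain ⟨e, he, hk⟩ := hmeet m n x hm hn
    have h1 := hs m e he _ hk
    have h2 := hu m (m⁻¹ * n) x hm (by rwa [mul_inv_cancel_left])
    rw [mul_inv_cancel_left] at h1 h2
    rw [h1, h2]
    group
  choose! μ hμ using hcover
  refine ⟨fun x => c x (P (μ x)) * (s (μ x))⁻¹, fun x x' hxx' hx' => ?_⟩
  simp only
  rw [hwd (μ x) (μ x') x (hμ x (hF x x' hxx' hx')) (hxx'.trans (hμ x' hx')),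
    ← hc x x' _ hxx' (hμ x' hx')]
  group

end Fibre

end Coprime

section ElementaryAbelian

variable {G Q : Type} [Group G] [Group Q] {p : ℕ}

theorem isElementaryAbelian_iff {H : Subgroup G} :
    IsElementaryAbelian p ↥H ↔ (∀ a ∈ H, ∀ b ∈ H, a * b = b * a) ∧ ∀ a ∈ H, a ^ p = 1 := by
  simp [IsElementaryAbelian, Subtype.ext_iff]

theorem mem_apSet_iff {H : Subgroup G} : H ∈ apSet p G ↔
    H ≠ ⊥ ∧ (∀ a ∈ H, ∀ b ∈ H, a * b = b * a) ∧ ∀ a ∈ H, a ^ p = 1 :=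
  and_congr_right fun _ => isElementaryAbelian_iff

theorem mem_apSet_of_le {H K : Subgroup G} (hK : K ∈ apSet p G) (h : H ≤ K) (hH : H ≠ ⊥) :
    H ∈ apSet p G := by
  rw [mem_apSet_iff] at hK ⊢
  exact ⟨hH, fun a ha b hb => hK.2.1 a (h ha) b (h hb), fun a ha => hK.2.2 a (h ha)⟩

theorem sup_mem_apSet {A D : Subgroup G} (hA : A ∈ apSet p G) (hD : D ∈ apSet p G)
    (h : D ≤ Subgroup.centralizer A) : A ⊔ D ∈ apSet p G := by
  rw [mem_apSet_iff] at hA hD ⊢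
  have hAA : A ≤ Subgroup.centralizer A := fun a ha b hb => hA.2.1 b hb a ha
  have hDD : D ≤ Subgroup.centralizer D := fun a ha b hb => hD.2.1 b hb a ha
  have hc : A ⊔ D ≤ Subgroup.centralizer (A ⊔ D : Subgroup G) := sup_le
    (Subgroup.le_centralizer_iff.1 (sup_le hAA h))
    (Subgroup.le_centralizer_iff.1 (sup_le (Subgroup.le_centralizer_iff.1 h) hDD))
  let T : Subgroup G :=
    { carrier := {x | x ∈ A ⊔ D ∧ x ^ p = 1}
      mul_mem' := fun {x y} hx hy => ⟨mul_mem hx.1 hy.1, by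
        rw [(show Commute x y from hc hy.1 x hx.1).mul_pow, hx.2, hy.2, one_mul]⟩
      one_mem' := ⟨one_mem _, one_pow _⟩
      inv_mem' := fun {x} hx => ⟨inv_mem hx.1, by rw [inv_pow, hx.2, inv_one]⟩ }
  have hT : A ⊔ D ≤ T := sup_le (fun a ha => ⟨Subgroup.mem_sup_left ha, hA.2.2 a ha⟩)
    fun d hd => ⟨Subgroup.mem_sup_right hd, hD.2.2 d hd⟩
  exact ⟨fun hbot => hA.1 (le_bot_iff.1 (le_sup_left.trans hbot.le)),
    fun a ha b hb => hc hb a ha, fun a ha => (hT ha).2⟩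

theorem map_mem_apSet {H : Subgroup G} (hH : H ∈ apSet p G) (f : G →* Q) (hf : H.map f ≠ ⊥) :
    H.map f ∈ apSet p Q := by
  rw [mem_apSet_iff] at hH ⊢
  refine ⟨hf, ?_, ?_⟩
  · rintro _ ⟨a, ha, rfl⟩ _ ⟨b, hb, rfl⟩
    rw [← map_mul, ← map_mul, hH.2.1 a ha b hb]
  · rintro _ ⟨a, ha, rfl⟩
    rw [← map_pow, hH.2.2 a ha, map_one]

theorem zpowers_mem_apSet {e : G} (he : e ^ p = 1) (h1 : e ≠ 1) :
    Subgroup.zpowers e ∈ apSet p G := by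
  refine mem_apSet_iff.2 ⟨by simpa using h1, ?_, ?_⟩
  · rintro _ ⟨i, rfl⟩ _ ⟨j, rfl⟩
    exact zpow_mul_comm e i j
  · rintro _ ⟨i, rfl⟩
    simp only
    rw [← zpow_natCast, ← zpow_mul, mul_comm, zpow_mul, zpow_natCast, he, one_zpow]

theorem isPGroup_of_mem_apSet {H : Subgroup G} (hH : H ∈ apSet p G) : IsPGroup p ↥H :=
  fun a => ⟨1, by rw [pow_one, hH.2.2]⟩

theorem exists_card_eq_pow_of_mem_apSet [Finite G] (hp : p.Prime) {H : Subgroup G}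
    (hH : H ∈ apSet p G) : ∃ n, Nat.card H = p ^ (n + 1) := by
  have := Fact.mk hp
  obtain ⟨n, hn⟩ := IsPGroup.iff_card.1 (isPGroup_of_mem_apSet hH)
  cases n with
  | zero => exact absurd (H.card_eq_one.1 (by simpa using hn)) hH.1
  | succ n => exact ⟨n, hn⟩

theorem eq_of_le_of_card_lt [Finite G] (hp : p.Prime) {H K : Subgroup G} (hH : H ∈ apSet p G)
    (hK : K ∈ apSet p G) (hle : H ≤ K) (hlt : Nat.card K < p ^ 2) : H = K := by
  obtain ⟨m, hm⟩ := exists_card_eq_pow_of_mem_apSet hp hH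
  obtain ⟨n, hn⟩ := exists_card_eq_pow_of_mem_apSet hp hK
  refine Subgroup.eq_of_le_of_card_ge hle ?_
  rw [hm, hn]
  rw [hn] at hlt
  have := (Nat.pow_lt_pow_iff_right hp.one_lt).1 hlt
  exact Nat.pow_le_pow_right hp.pos (by omega)

/-- The Quillen poset of a finite group with a nontrivial normal elementary abelian `p`-subgroup
has the cocycle lifting property. -/
theorem hasCocycleLifting_of_normal [Finite G] (hp : p.Prime) {N : Subgroup G} [N.Normal]
    (hN : N ∈ apSet p G) : HasCocycleLifting ↥(apSet p G) := by
  have := Fact.mk hp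
  have hbot : ∀ A ∈ apSet p G, N ⊓ Subgroup.centralizer A ≠ ⊥ := by
    intro A hA
    let _ : MulAction A N := MulAction.compHom N ((MulAut.conjNormal (H := N)).comp A.subtype)
    have hsmul : ∀ (a : A) (x : N), ((a • x : N) : G) = a * x * (a : G)⁻¹ := fun a x => rfl
    obtain ⟨n, hn⟩ := exists_card_eq_pow_of_mem_apSet hp hN
    have hAp := isPGroup_of_mem_apSet hA
    obtain ⟨b, hb, hne⟩ := hAp.exists_fixed_point_of_prime_dvd_card_of_fixed_point
      N (hn ▸ dvd_pow_self p n.succ_ne_zero) (a := 1) (fun a => Subtype.ext (by simp [hsmul]))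
    refine fun hbot => hne (Subtype.ext ?_)
    have hmem : (b : G) ∈ N ⊓ Subgroup.centralizer A := ⟨b.2, fun a ha => by
      have := hsmul ⟨a, ha⟩ b
      rw [hb ⟨a, ha⟩] at this
      exact (eq_mul_inv_iff_mul_eq.1 this).symm⟩
    rw [hbot, Subgroup.mem_bot] at hmem
    exact hmem.symm
  intro H E _ _ q hq c hc
  obtain ⟨h, hh⟩ := exists_primitive_of_antitone hc ⟨N, hN⟩
    (fun A => ⟨N ⊓ Subgroup.centralizer A, mem_apSet_of_le hN inf_le_left (hbot A A.2)⟩)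
    (fun A B hAB => inf_le_inf_left N (Subgroup.centralizer_le hAB))
    (fun A => show N ⊓ _ ≤ N from inf_le_left)
    fun A d hd =>
      ⟨⟨A.1 ⊔ d.1, sup_mem_apSet A.2 d.2 (le_trans (show d.1 ≤ _ from hd) inf_le_right)⟩, by
        constructor
        · rintro x (rfl | rfl)
          · exact le_sup_left (a := x.1)
          · exact le_sup_right (b := x.1)
        · intro x hx
          exact sup_le (show A.1 ≤ x.1 from hx (Set.mem_insert _ _))
            (show d.1 ≤ x.1 from hx (Set.mem_insert_of_mem _ rfl))⟩
  exact exists_lift_of_primitive hq hh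

end ElementaryAbelian

section CoprimeKernel

variable {G Q : Type} [Group G] [Group Q] {p : ℕ} {π : G →* Q}

theorem IsPGroup.injOn_of_coprime_card_ker (hcop : (Nat.card π.ker).Coprime p)
    {A : Subgroup G} (hA : IsPGroup p ↥A) : Set.InjOn π A := by
  intro a ha b hb hab
  have hmem : a * b⁻¹ ∈ A := mul_mem ha (inv_mem hb)
  have hker : a * b⁻¹ ∈ π.ker := by rw [π.mem_ker, map_mul, map_inv, hab, mul_inv_cancel]
  obtain ⟨k, hk⟩ := hA ⟨_, hmem⟩
  have h1 : orderOf (a * b⁻¹) ∣ p ^ k := orderOf_dvd_of_pow_eq_one (by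
    simpa [Subtype.ext_iff] using hk)
  have h2 : orderOf (a * b⁻¹) ∣ Nat.card π.ker := by
    rw [← Subgroup.orderOf_mk _ hker]
    exact orderOf_dvd_natCard _
  have := Nat.eq_one_of_dvd_coprimes (hcop.pow_right k) h2 h1
  exact mul_inv_eq_one.1 (orderOf_eq_one_iff.1 this)

theorem card_map_of_injOn {A : Subgroup G} (h : Set.InjOn π A) :
    Nat.card (A.map π) = Nat.card A :=
  Nat.card_image_of_injOn h

theorem map_mem_apSet_of_coprime (hcop : (Nat.card π.ker).Coprime p)
    {A : Subgroup G} (hA : A ∈ apSet p G) : A.map π ∈ apSet p Q := by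
  refine map_mem_apSet hA π fun h => hA.1 ?_
  rw [← Subgroup.card_eq_one,
    ← card_map_of_injOn ((isPGroup_of_mem_apSet hA).injOn_of_coprime_card_ker hcop), h,
    Subgroup.card_bot]

theorem mem_map_conj {A : Subgroup G} {m x : G} :
    x ∈ A.map (MulAut.conj m).toMonoidHom ↔ m⁻¹ * x * m ∈ A := by
  constructor
  · rintro ⟨a, ha, rfl⟩
    simpa [mul_assoc] using ha
  · intro h
    exact ⟨_, h, by simp [mul_assoc]⟩

theorem map_map_conj_of_mem_ker (A : Subgroup G) {m : G} (hm : m ∈ π.ker) :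
    (A.map (MulAut.conj m).toMonoidHom).map π = A.map π := by
  rw [Subgroup.map_map]
  congr 1
  ext a
  simp [π.mem_ker.1 hm]

/-- Elementary abelian subgroups lift along a surjection with kernel of coprime order, and the
lifts absorb, up to conjugation by the kernel, all elementary abelian subgroups over them. -/
theorem exists_map_eq_of_mem_apSet [Finite G] (hp : p.Prime) (hπ : Surjective π)
    (hcop : (Nat.card π.ker).Coprime p) {y : Subgroup Q} (hy : y ∈ apSet p Q) :
    ∃ A ∈ apSet p G, A.map π = y ∧ ∀ B ∈ apSet p G, B.map π ≤ y →
      ∃ m ∈ π.ker, B ≤ A.map (MulAut.conj m).toMonoidHom := by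
  have := Fact.mk hp
  let K : Subgroup G := y.comap π
  obtain ⟨P⟩ : Nonempty (Sylow p K) := inferInstance
  have hsurj : Surjective (π.subgroupComap y) := π.subgroupComap_surjective_of_surjective y hπ
  have htop : (⊤ : Subgroup y) = (P.mapSurjective hsurj : Subgroup y) :=
    (P.mapSurjective hsurj).is_maximal' ((isPGroup_of_mem_apSet hy).to_subgroup ⊤) le_top
  let A : Subgroup G := (P : Subgroup K).map K.subtype
  have hAp : IsPGroup p A := P.2.map K.subtype
  have hAy : A.map π = y := by
    apply le_antisymm
    · rintro _ ⟨_, ⟨k, -, rfl⟩, rfl⟩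
      exact k.2
    · intro q hq
      have h : (⟨q, hq⟩ : y) ∈ (P.mapSurjective hsurj : Subgroup y) := htop ▸ Subgroup.mem_top _
      rw [Sylow.coe_mapSurjective] at h
      obtain ⟨k, hk, hkq⟩ := h
      exact ⟨k, ⟨k, hk, rfl⟩, congrArg Subtype.val hkq⟩
  have hinj := hAp.injOn_of_coprime_card_ker hcop
  refine ⟨A, mem_apSet_iff.2 ⟨?_, ?_, ?_⟩, hAy, ?_⟩
  · intro h
    apply hy.1
    rw [← hAy, h, Subgroup.map_bot]
  · intro a ha b hb
    apply hinj (mul_mem ha hb) (mul_mem hb ha)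
    rw [map_mul, map_mul]
    exact (mem_apSet_iff.1 hy).2.1 _ (hAy ▸ ⟨a, ha, rfl⟩) _ (hAy ▸ ⟨b, hb, rfl⟩)
  · intro a ha
    apply hinj (pow_mem ha _) (one_mem _)
    rw [map_pow, map_one]
    exact (mem_apSet_iff.1 hy).2.2 _ (hAy ▸ ⟨a, ha, rfl⟩)
  · intro B hB hBy
    have hBK : B ≤ K := Subgroup.map_le_iff_le_comap.1 hBy
    obtain ⟨P', hP'⟩ := ((isPGroup_of_mem_apSet hB).comap_of_injective K.subtype
      K.subtype_injective).exists_le_sylow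
    obtain ⟨g, rfl⟩ := MulAction.exists_smul_eq K P P'
    obtain ⟨a, ha, hag⟩ : π g ∈ A.map π := hAy ▸ g.2
    refine ⟨g * a⁻¹, by rw [π.mem_ker, map_mul, map_inv, hag, mul_inv_cancel], fun b hb => ?_⟩
    have hbP := hP' (show (⟨b, hBK hb⟩ : K) ∈ _ from hb)
    rw [Sylow.coe_subgroup_smul, Subgroup.mem_pointwise_smul_iff_inv_smul_mem] at hbP
    have hbA : (g : G)⁻¹ * b * g ∈ A := ⟨_, hbP, by simp [MulAut.smul_def]⟩
    rw [mem_map_conj]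
    convert mul_mem (mul_mem ha hbA) (inv_mem ha) using 1
    group

theorem exists_ne_pow {A : Type} [Group A] [Finite A] (hp : p.Prime) (hA : ∀ a : A, a ^ p = 1)
    (hcard : p < Nat.card A) (b : A) : ∃ a, ∀ i : ℕ, a ≠ b ^ i := by
  by_contra! h
  have hsurj : Surjective fun i : Fin p => b ^ (i : ℕ) := fun a => by
    obtain ⟨i, rfl⟩ := h a
    exact ⟨⟨i % p, Nat.mod_lt _ hp.pos⟩, (pow_eq_pow_mod i (hA b)).symm⟩
  have := Nat.card_le_card_of_surjective _ hsurj
  rw [Nat.card_fin] at this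
  omega

theorem exists_ne_pow_mul_pow {A : Type} [Group A] [Finite A] (hp : p.Prime)
    (hA : ∀ a : A, a ^ p = 1) (hcard : p ^ 2 < Nat.card A) (b y : A) :
    ∃ a, ∀ i j : ℕ, a ≠ b ^ i * y ^ j := by
  by_contra! h
  have hsurj : Surjective fun i : Fin p × Fin p => b ^ (i.1 : ℕ) * y ^ (i.2 : ℕ) := fun a => by
    obtain ⟨i, j, rfl⟩ := h a
    refine ⟨⟨⟨i % p, Nat.mod_lt _ hp.pos⟩, ⟨j % p, Nat.mod_lt _ hp.pos⟩⟩, ?_⟩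
    simp only
    rw [← pow_eq_pow_mod i (hA b), ← pow_eq_pow_mod j (hA y)]
  have := Nat.card_le_card_of_surjective _ hsurj
  rw [Nat.card_prod, Nat.card_fin] at this
  nlinarith

/-- Conjugation by an element, as a self-map of the Quillen poset. -/
def conjApSet (A : apSet p G) (m : G) : apSet p G :=
  ⟨A.1.map (MulAut.conj m).toMonoidHom, map_mem_apSet A.2 _ fun h =>
    A.2.1 ((Subgroup.map_eq_bot_iff_of_injective _ (MulAut.conj m).injective).1 h)⟩

theorem exists_le_conjApSet_mul (A : apSet p G) {e : G} (heA : e ∈ A.1) (he : e ≠ 1) (m : G) :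
    ∃ x : apSet p G, ∀ k, e * k * e⁻¹ = k → x ≤ conjApSet A (m * k) := by
  have hep : e ^ p = 1 := (mem_apSet_iff.1 A.2).2.2 e heA
  refine ⟨conjApSet ⟨_, zpowers_mem_apSet hep he⟩ m, fun k hk => ?_⟩
  rintro _ ⟨x, hx, rfl⟩
  obtain ⟨i, rfl⟩ := hx
  have hcomm : Commute (e ^ i) k := Commute.zpow_left (mul_inv_eq_iff_eq_mul.1 hk) i
  refine mem_map_conj.2 ?_
  have : (m * k)⁻¹ * (m * e ^ i * m⁻¹) * (m * k) = e ^ i := by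
    calc _ = k⁻¹ * (e ^ i * k) := by group
      _ = e ^ i := by rw [hcomm.eq, inv_mul_cancel_left]
  exact this ▸ zpow_mem heA i

theorem exists_commute_of_le_conjApSet (hcop : (Nat.card π.ker).Coprime p) (A x : apSet p G)
    {m n : G} (hm : m ∈ π.ker) (hn : n ∈ π.ker) (hxm : x ≤ conjApSet A m)
    (hxn : x ≤ conjApSet A n) : ∃ e ∈ A.1, e ≠ 1 ∧ e * (m⁻¹ * n) * e⁻¹ = m⁻¹ * n := by
  obtain ⟨b, hb⟩ := Subgroup.ne_bot_iff_exists_ne_one.1 x.2.1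
  have h1 : m⁻¹ * b * m ∈ A.1 := mem_map_conj.1 (hxm b.2)
  have h2 : n⁻¹ * b * n ∈ A.1 := mem_map_conj.1 (hxn b.2)
  have heq : m⁻¹ * b * m = n⁻¹ * b * n :=
    (isPGroup_of_mem_apSet A.2).injOn_of_coprime_card_ker hcop h1 h2 (by
      simp [π.mem_ker.1 hm, π.mem_ker.1 hn])
  refine ⟨_, h1, fun h => hb (Subtype.ext ?_), ?_⟩
  · simpa [mul_assoc, inv_mul_eq_one, eq_comm (a := m)] using h
  · rw [mul_inv_eq_iff_eq_mul]
    conv_rhs => rw [heq]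
    group

theorem isGLB_conjApSet (A x : apSet p G) {m n : G} (hxm : x ≤ conjApSet A m)
    (hxn : x ≤ conjApSet A n) : ∃ z, IsGLB {conjApSet A m, conjApSet A n} z := by
  have hx : x.1 ≤ (conjApSet A m).1 ⊓ (conjApSet A n).1 := le_inf hxm hxn
  refine ⟨⟨(conjApSet A m).1 ⊓ (conjApSet A n).1, mem_apSet_of_le (conjApSet A m).2 inf_le_left
    fun h => x.2.1 (le_bot_iff.1 (hx.trans h.le))⟩, ?_, ?_⟩
  · rintro w (rfl | rfl)
    · exact inf_le_left (a := (conjApSet A m).1)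
    · exact inf_le_right (a := (conjApSet A m).1)
  · intro w hw
    exact le_inf (show w.1 ≤ (conjApSet A m).1 from hw (Set.mem_insert _ _))
      (show w.1 ≤ (conjApSet A n).1 from hw (Set.mem_insert_of_mem _ rfl))

variable [Finite G]

open scoped IsMulCommutative in
/-- The elementary abelian subgroups over a subgroup of rank at least two form a connected poset. -/
theorem eq_of_locally_constant_of_map_le [IsMulCommutative π.ker] (hp : p.Prime)
    (hπ : Surjective π) (hcop : (Nat.card π.ker).Coprime p) {y : Subgroup Q} (hy : y ∈ apSet p Q)
    (hcard : p < Nat.card y) {Z : Type} (φ : apSet p G → Z)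
    (hφ : ∀ x x', x ≤ x' → x'.1.map π ≤ y → φ x = φ x') {x x' : apSet p G}
    (hx : x.1.map π ≤ y) (hx' : x'.1.map π ≤ y) : φ x = φ x' := by
  obtain ⟨A, hA, rfl, hcover⟩ := exists_map_eq_of_mem_apSet hp hπ hcop hy
  have : IsMulCommutative A := ⟨⟨hA.2.1⟩⟩
  rw [card_map_of_injOn ((isPGroup_of_mem_apSet hA).injOn_of_coprime_card_ker hcop)] at hcard
  refine eq_of_locally_constant (M := π.ker) (A := A) (p := p) (F := fun x => x.1.map π ≤ A.map π)
    (ρ := (MulAut.conjNormal (H := π.ker)).comp A.subtype)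
    (P := fun m => conjApSet ⟨A, hA⟩ m) hp hcop hA.2.2 (exists_ne_pow hp hA.2.2 hcard)
    (fun m => (map_map_conj_of_mem_ker A m.2).le) ?_ ?_ φ hφ hx hx'
  · intro x hx
    obtain ⟨m, hm, h⟩ := hcover x.1 x.2 hx
    exact ⟨⟨m, hm⟩, h⟩
  · intro e he m
    obtain ⟨x, hx⟩ := exists_le_conjApSet_mul ⟨A, hA⟩ e.2 (by simpa using he) m
    refine ⟨x, fun k hk => hx k ?_⟩
    simpa [mem_fixedSubgroup, Subtype.ext_iff] using hk

open scoped IsMulCommutative in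
/-- Cocycles on the poset of elementary abelian subgroups over a subgroup of rank at least three
are coboundaries. -/
theorem exists_primitive_of_map_le [IsMulCommutative π.ker] (hp : p.Prime)
    (hπ : Surjective π) (hcop : (Nat.card π.ker).Coprime p) {y : Subgroup Q} (hy : y ∈ apSet p Q)
    (hcard : p ^ 2 < Nat.card y) {H : Type} [Group H] {c : apSet p G → apSet p G → H}
    (hc : IsPosetCocycle c) :
    ∃ g : apSet p G → H, ∀ x x', x ≤ x' → x'.1.map π ≤ y → c x x' = g x * (g x')⁻¹ := by
  obtain ⟨A, hA, rfl, hcover⟩ := exists_map_eq_of_mem_apSet hp hπ hcop hy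
  have : IsMulCommutative A := ⟨⟨hA.2.1⟩⟩
  rw [card_map_of_injOn ((isPGroup_of_mem_apSet hA).injOn_of_coprime_card_ker hcop)] at hcard
  have hcard' : p < Nat.card A := lt_of_le_of_lt (Nat.le_self_pow two_ne_zero p) hcard
  refine exists_primitive_of_fibre (M := π.ker) (A := A) (p := p)
    (F := fun x => x.1.map π ≤ A.map π)
    (ρ := (MulAut.conjNormal (H := π.ker)).comp A.subtype)
    (P := fun m => conjApSet ⟨A, hA⟩ m) hp hcop hA.2.2 (exists_ne_pow hp hA.2.2 hcard')
    (exists_ne_pow_mul_pow hp hA.2.2 hcard)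
    (fun x x' h hx' => (Subgroup.map_mono h).trans hx') ?_ ?_ ?_ ?_ hc
  · intro x hx
    obtain ⟨m, hm, h⟩ := hcover x.1 x.2 hx
    exact ⟨⟨m, hm⟩, h⟩
  · intro e he m
    obtain ⟨x, hx⟩ := exists_le_conjApSet_mul ⟨A, hA⟩ e.2 (by simpa using he) m
    refine ⟨x, fun k hk => hx k ?_⟩
    simpa [mem_fixedSubgroup, Subtype.ext_iff] using hk
  · intro m n x hm hn
    obtain ⟨e, heA, he, h⟩ := exists_commute_of_le_conjApSet hcop ⟨A, hA⟩ x m.2 n.2 hm hn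
    refine ⟨⟨e, heA⟩, by simpa using he, ?_⟩
    exact mem_fixedSubgroup.2 (Subtype.ext h)
  · exact fun m n x => isGLB_conjApSet _ x

/-- The cocycle lifting property of Quillen posets ascends along a surjection with abelian kernel
of order prime to `p`. -/
theorem hasCocycleLifting_of_coprime_ker [Finite Q] [IsMulCommutative π.ker] (hp : p.Prime)
    (hπ : Surjective π) (hcop : (Nat.card π.ker).Coprime p)
    (hQ : HasCocycleLifting ↥(apSet p Q)) : HasCocycleLifting ↥(apSet p G) := by
  let f : apSet p G → apSet p Q := fun x => ⟨x.1.map π, map_mem_apSet_of_coprime hcop x.2⟩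
  have hf : Monotone f := fun x x' h => Subgroup.map_mono (f := π) h
  have hfcard : ∀ x, Nat.card (f x).1 = Nat.card x.1 := fun x =>
    card_map_of_injOn ((isPGroup_of_mem_apSet x.2).injOn_of_coprime_card_ker hcop)
  have hsmall : ∀ x w : apSet p G, x ≤ w → Nat.card (f w).1 < p ^ 2 → x = w := fun x w h hw =>
    Subtype.ext (eq_of_le_of_card_lt hp x.2 w.2 h (hfcard w ▸ hw))
  have hlt : ∀ {K : Type} [Group K] [Finite K] {x w : Subgroup K}, x < w →
      Nat.card x < Nat.card w := fun {K} _ _ x w h =>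
    lt_of_not_ge fun hge => h.ne (Subgroup.eq_of_le_of_card_ge h.le hge)
  choose σ hσ hσf using fun y : apSet p Q =>
    (exists_map_eq_of_mem_apSet hp hπ hcop y.2).imp fun A h => And.intro h.1 h.2.1
  refine hasCocycleLifting_of_vanishing (fun x => Nat.card (f x).1 = p ^ 2 ∧ IsMax (f x))
    ?_ ?_ ?_
  · intro x z hx hxz
    exact (hx.2.eq_of_le (hf hxz)) ▸ hx
  · intro x y z hz hyz hxy
    refine hsmall x y hxy ?_
    rw [hfcard, ← hz.1, hfcard]
    exact hlt hyz
  · intro H E _ _ q hq c hc hcT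
    refine exists_lift_of_fibration hf hQ (fun y => p ^ 2 ≤ Nat.card y.1)
      (fun x w h hw => hsmall x w h (not_le.1 hw))
      (fun y z h hz => Subtype.ext (eq_of_le_of_card_lt hp y.2 z.2 h (not_le.1 hz)))
      (fun y => ⟨σ y, hσ y⟩) (fun y => (hσf y).le) ?_ hq hc ?_
    · intro y hy φ hφ x x' hx hx'
      exact eq_of_locally_constant_of_map_le hp hπ hcop y.2
        (lt_of_lt_of_le (by simpa using Nat.pow_lt_pow_right hp.one_lt one_lt_two) hy) φ hφ hx hx'
    · intro y hy
      rcases hy.lt_or_eq with hlt' | heq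
      · exact exists_primitive_of_map_le hp hπ hcop y.2 hlt' hc
      · by_cases hmax : IsMax y
        · refine ⟨1, fun x x' hxx' hx' => ?_⟩
          rcases hx'.eq_or_lt with rfl | h
          · simpa using hcT x x' ⟨heq.symm, hmax⟩
          · obtain rfl := hsmall x x' hxx' (heq ▸ hlt h)
            simp [hc.self]
        · obtain ⟨z, hz⟩ := not_isMax_iff.1 hmax
          obtain ⟨g, hg⟩ := exists_primitive_of_map_le hp hπ hcop z.2 (heq ▸ hlt hz) hc
          exact ⟨g, fun x x' h hx' => hg x x' h (le_trans (show _ ≤ y.1 from hx') hz.le)⟩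

end CoprimeKernel

section Solvable

variable {G : Type} [Group G]

theorem exists_normal_isMulCommutative [Nontrivial G] [Group.IsSolvable G] :
    ∃ M : Subgroup G, M.Normal ∧ IsMulCommutative M ∧ M ≠ ⊥ := by
  classical
  have hex : ∃ n, derivedSeries G n = ⊥ := Group.IsSolvable.solvable
  obtain ⟨n, hn⟩ : ∃ n, Nat.find hex = n + 1 := Nat.exists_eq_succ_of_ne_zero fun h => by
    have := Nat.find_spec hex
    rw [h, derivedSeries_zero] at this
    exact top_ne_bot this
  refine ⟨derivedSeries G n, inferInstance, ?_, Nat.find_min hex (by omega)⟩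
  have h := Nat.find_spec hex
  rw [hn, derivedSeries_succ, Subgroup.commutator_eq_bot_iff_le_centralizer] at h
  exact ⟨⟨fun a b => Subtype.ext (h b.2 a a.2)⟩⟩

theorem exists_normal_mem_apSet [Finite G] {p : ℕ} (hp : p.Prime) {M : Subgroup G} [hM : M.Normal]
    [IsMulCommutative M] (hdvd : p ∣ Nat.card M) : ∃ N : Subgroup G, N.Normal ∧ N ∈ apSet p G := by
  have := Fact.mk hp
  have hcomm : ∀ a ∈ M, ∀ b ∈ M, a * b = b * a := fun a ha b hb =>
    congrArg Subtype.val (mul_comm' (⟨a, ha⟩ : M) ⟨b, hb⟩)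
  let N : Subgroup G :=
    { carrier := {x | x ∈ M ∧ x ^ p = 1}
      mul_mem' := fun {x y} hx hy => ⟨mul_mem hx.1 hy.1, by
        rw [(show Commute x y from hcomm x hx.1 y hy.1).mul_pow, hx.2, hy.2, one_mul]⟩
      one_mem' := ⟨one_mem _, one_pow _⟩
      inv_mem' := fun {x} hx => ⟨inv_mem hx.1, by rw [inv_pow, hx.2, inv_one]⟩ }
  refine ⟨N, ⟨fun x hx g => ⟨hM.conj_mem x hx.1 g, by rw [conj_pow, hx.2]; group⟩⟩,
    mem_apSet_iff.2 ⟨fun h => ?_, fun a ha b hb => hcomm a ha.1 b hb.1, fun a ha => ha.2⟩⟩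
  obtain ⟨x, hx⟩ := exists_prime_orderOf_dvd_card' p hdvd
  have hxN : (x : G) ∈ N := ⟨x.2, by
    rw [← Subgroup.coe_pow, ← hx, pow_orderOf_eq_one, Subgroup.coe_one]⟩
  rw [h, Subgroup.mem_bot, OneMemClass.coe_eq_one] at hxN
  rw [hxN, orderOf_one] at hx
  exact hp.one_lt.ne hx

theorem hasCocycleLifting_apSet {p : ℕ} (hp : p.Prime) (G : Type) [Group G] [Finite G]
    [Group.IsSolvable G] : HasCocycleLifting ↥(apSet p G) := by
  induction h : Nat.card G using Nat.strong_induction_on generalizing G with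
  | _ n ih =>
    subst h
    rcases subsingleton_or_nontrivial G with hG | hG
    · exact fun H E _ _ q hq c hc =>
        ⟨1, fun _ _ _ _ _ => one_mul 1, fun x => absurd (Subsingleton.elim _ _) x.2.1⟩
    · obtain ⟨M, hM, hMc, hbot⟩ := exists_normal_isMulCommutative (G := G)
      by_cases hdvd : p ∣ Nat.card M
      · obtain ⟨N, hN, hNA⟩ := exists_normal_mem_apSet hp hdvd
        exact hasCocycleLifting_of_normal hp hNA
      · have hker : (QuotientGroup.mk' M).ker = M := QuotientGroup.ker_mk' M
        have : IsMulCommutative (QuotientGroup.mk' M).ker := hker.symm ▸ hMc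
        refine hasCocycleLifting_of_coprime_ker (π := QuotientGroup.mk' M) hp
          (QuotientGroup.mk'_surjective M) ?_ (ih _ ?_ (G ⧸ M) rfl)
        · rw [hker]
          exact ((Nat.Prime.coprime_iff_not_dvd hp).2 hdvd).symm
        · rw [M.card_eq_card_quotient_mul_card_subgroup]
          exact lt_mul_of_one_lt_right Nat.card_pos (Subgroup.one_lt_card_iff_ne_bot M |>.2 hbot)

end Solvable

/-- If `G` is a finite solvable group and `p` is a prime dividing `|G|`,
then every connected component of the geometric realization of `K(A_p(G))` has free
fundamental group. -/
theorem stmt2 (G : Type) [Group G] [Finite G] (p : ℕ) (hp : p.Prime)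
    (hdvd : p ∣ Nat.card G) (hsolv : IsSolvable G) :
    ∀ x : ↥(geomRealOn (apSet p G)), ∃ S : Type,
      Nonempty (FundamentalGroup ↥(geomRealOn (apSet p G)) x ≃* FreeGroup S) := by
  intro x
  have : Group.IsSolvable G := hsolv
  have := isFreeGroup_fundamentalGroup_geomRealOn (hasCocycleLifting_apSet hp G) x
  exact ⟨IsFreeGroup.Generators _, ⟨IsFreeGroup.toFreeGroup _⟩⟩
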